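/- arXiv:2305.14559 — 2 statements merged into one kernel-verified Lean document; each statement's English description precedes it below -/
import Mathlib

section
/- For every irrational number α there exists a dense G_δ subset R(α) of the space 𝒫 such that for every 𝔣 ∈ R(α), the random walk on the circle with transition kernel p(x,·) = 𝔭(x)δ_{x+α} + 𝔮(x)δ_{x−α} (where 𝔭(x) = e^{𝔣(x)}/(1+e^{𝔣(x)}) and 𝔮 = 1 − 𝔭) is mixing. -/
open MeasureTheory Filter Finset

noncomputable section

attribute [local instance] Classical.propDecidable

/-- The point `x + j·α` on the circle `𝕋 = ℝ/ℤ`. -/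
def pt (α : ℝ) (x : UnitAddCircle) (j : ℤ) : UnitAddCircle :=
  x + (((j : ℝ) * α : ℝ) : UnitAddCircle)

/-- One-step transition probability of the random walk on `ℤ` in the quasi-periodic
environment `(𝔭, α, x)`: from `j` it jumps to `j+1` with probability `𝔭(x+jα)` and to
`j-1` with probability `𝔮(x+jα) = 1-𝔭(x+jα)`. -/
def stepProb (𝔭 : UnitAddCircle → ℝ) (α : ℝ) (x : UnitAddCircle) (j j' : ℤ) : ℝ :=
  if j' = j + 1 then 𝔭 (pt α x j) else if j' = j - 1 then 1 - 𝔭 (pt α x j) else 0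

/-- `ξ` is (a version of) the random walk on `ℤ` in the quasi-periodic environment
`(𝔭, α, x)` started at `start`, defined on the probability space `(Ω, ℙ)`; this is
expressed through its finite-dimensional distributions. -/
def IsQPWalk (𝔭 : UnitAddCircle → ℝ) (α : ℝ) (x : UnitAddCircle) (start : ℤ)
    {Ω : Type} [MeasurableSpace Ω] (ℙ : Measure Ω) (ξ : ℕ → Ω → ℤ) : Prop :=
  IsProbabilityMeasure ℙ ∧ (∀ n, Measurable (ξ n)) ∧
  ∀ (n : ℕ) (k : ℕ → ℤ),
    ℙ {ω | ∀ i ≤ n, ξ i ω = k i} =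
      ENNReal.ofReal ((if k 0 = start then (1 : ℝ) else 0) *
        ∏ i ∈ Finset.range n, stepProb 𝔭 α x (k i) (k (i + 1)))

/-- `𝔣` is continuous, of bounded variation, with `∫_𝕋 𝔣(z) dz = 0`. -/
def ZeroMeanBV (𝔣 : UnitAddCircle → ℝ) : Prop :=
  Continuous 𝔣 ∧ BoundedVariationOn (fun t : ℝ => 𝔣 (t : UnitAddCircle)) (Set.Icc 0 1) ∧
    ∫ z : UnitAddCircle, 𝔣 z = 0

/-- The function `𝔭 = e^𝔣/(1+e^𝔣)` associated to `𝔣`. -/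
def pOf (𝔣 : UnitAddCircle → ℝ) : UnitAddCircle → ℝ :=
  fun z => Real.exp (𝔣 z) / (1 + Real.exp (𝔣 z))

/-- `f : ℝ → ℝ` is absolutely continuous on `[0,1]`. -/
def AbsolutelyContinuousOn01 (f : ℝ → ℝ) : Prop :=
  ∀ ε > 0, ∃ δ > 0, ∀ (n : ℕ) (a b : Fin n → ℝ),
    (∀ i, a i ∈ Set.Icc (0:ℝ) 1 ∧ b i ∈ Set.Icc (0:ℝ) 1 ∧ a i ≤ b i) →
    (Pairwise fun i j => Disjoint (Set.Ioo (a i) (b i)) (Set.Ioo (a j) (b j))) →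
    ∑ i, (b i - a i) < δ → ∑ i, |f (b i) - f (a i)| < ε

/-- Membership in the space `𝒫` of absolutely continuous functions on the circle with
`∫_𝕋 𝔣(z) dz = 0`. -/
def memP (𝔣 : UnitAddCircle → ℝ) : Prop :=
  Continuous 𝔣 ∧ AbsolutelyContinuousOn01 (fun t : ℝ => 𝔣 (t : UnitAddCircle)) ∧
    ∫ z : UnitAddCircle, 𝔣 z = 0

/-- The norm `‖f‖_BV = ‖f‖_∞ + var(f)` on functions on the circle. -/
def bvNorm (f : UnitAddCircle → ℝ) : ℝ :=
  (⨆ x : UnitAddCircle, |f x|) +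
    (eVariationOn (fun t : ℝ => f (t : UnitAddCircle)) (Set.Icc 0 1)).toReal

/-- The random walk on the circle with transition kernel
`p(x,·) = 𝔭(x) δ_{x+α} + (1-𝔭(x)) δ_{x-α}` is mixing: there is a Borel probability
measure `μ⋆` such that `E φ(X_n^x) → ∫ φ dμ⋆` for every starting point `x` and every
continuous `φ`, where `X_n^x = x + ξ_n α`. -/
def Mixing (𝔭 : UnitAddCircle → ℝ) (α : ℝ) : Prop :=
  ∃ μstar : Measure UnitAddCircle, IsProbabilityMeasure μstar ∧
    ∀ (x : UnitAddCircle) (Ω : Type) [MeasurableSpace Ω] (ℙ : Measure Ω) (ξ : ℕ → Ω → ℤ),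
      IsQPWalk 𝔭 α x 0 ℙ ξ →
      ∀ φ : C(UnitAddCircle, ℝ),
        Tendsto (fun n => ∫ ω, φ (pt α x (ξ n ω)) ∂ℙ) atTop
          (nhds (∫ z, φ z ∂μstar))

/-- one-step operator -/
def opP (p : UnitAddCircle → ℝ) (a : UnitAddCircle) :
    Module.End ℝ (UnitAddCircle → ℝ) where
  toFun φ x := p x * φ (x + a) + (1 - p x) * φ (x - a)
  map_add' φ ψ := by ext x; simp; ring
  map_smul' c φ := by ext x; simp; ring

lemma opP_apply (p : UnitAddCircle → ℝ) (a : UnitAddCircle) (φ : UnitAddCircle → ℝ)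
    (x : UnitAddCircle) :
    opP p a φ x = p x * φ (x + a) + (1 - p x) * φ (x - a) := rfl

section abstractop
variable {X : Type*} (T : Module.End ℝ (X → ℝ))

lemma T_pos_pow (hpos : ∀ u, 0 ≤ u → 0 ≤ T u) (n : ℕ) (u : X → ℝ) (hu : 0 ≤ u) :
    0 ≤ (T ^ n) u := by
  induction n with
  | zero => simpa using hu
  | succ n ih => rw [pow_succ']; exact hpos _ ih

lemma T_one_pow (h1 : T 1 = 1) (n : ℕ) : (T ^ n) 1 = 1 := by
  induction n with
  | zero => simp
  | succ n ih => rw [pow_succ', Module.End.mul_apply, ih, h1]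

lemma T_le_pow (hpos : ∀ u, 0 ≤ u → 0 ≤ T u) (h1 : T 1 = 1) (n : ℕ) (u : X → ℝ) (b : ℝ)
    (hu : ∀ x, u x ≤ b) (x : X) : (T ^ n) u x ≤ b := by
  have h := T_pos_pow T hpos n (b • (1 : X → ℝ) - u) (fun x => by simpa using hu x) x
  rw [map_sub, map_smul, T_one_pow T h1] at h
  simpa using h

lemma T_ge_pow (hpos : ∀ u, 0 ≤ u → 0 ≤ T u) (h1 : T 1 = 1) (n : ℕ) (u : X → ℝ) (b : ℝ)
    (hu : ∀ x, b ≤ u x) (x : X) : b ≤ (T ^ n) u x := by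
  have h := T_pos_pow T hpos n (u - b • (1 : X → ℝ)) (fun x => by simpa using hu x) x
  rw [map_sub, map_smul, T_one_pow T h1] at h
  simpa using h

lemma T_abs_pow (hpos : ∀ u, 0 ≤ u → 0 ≤ T u) (h1 : T 1 = 1) (n : ℕ) (u : X → ℝ) (k b : ℝ)
    (hu : ∀ x, |u x - k| ≤ b) (x : X) : |(T ^ n) u x - k| ≤ b := by
  rw [abs_le]
  have h1' := T_le_pow T hpos h1 n u (k + b) (fun x => by linarith [(abs_le.1 (hu x)).2]) x
  have h2 := T_ge_pow T hpos h1 n u (k - b) (fun x => by linarith [(abs_le.1 (hu x)).1]) x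
  constructor <;> linarith

lemma T_lazy_pow {δ : ℝ} (hδ0 : 0 < δ) (hδ : ∀ u, 0 ≤ u → δ • u ≤ T u)
    (n : ℕ) (u : X → ℝ) (hu : 0 ≤ u) : δ ^ n • u ≤ (T ^ n) u := by
  have hpos : ∀ u, 0 ≤ u → 0 ≤ T u := fun u hu =>
    le_trans (fun x => mul_nonneg hδ0.le (hu x)) (hδ u hu)
  induction n with
  | zero => simp
  | succ n ih =>
    rw [pow_succ', pow_succ', Module.End.mul_apply]
    refine le_trans ?_ (hδ _ (T_pos_pow T hpos n u hu))
    intro x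
    have := ih x
    simp only [Pi.smul_apply, smul_eq_mul] at this ⊢
    rw [mul_assoc]
    exact mul_le_mul_of_nonneg_left this hδ0.le

lemma lazy_lemma {δ : ℝ} (hδ0 : 0 < δ) (hδ1 : δ ≤ 1) (h1 : T 1 = 1)
    (hδ : ∀ u, 0 ≤ u → δ • u ≤ T u) (ψ : X → ℝ) (C : ℝ) (hC : ∀ x, |ψ x| ≤ C)
    {ε : ℝ} (hε : 0 < ε) : ∃ n, ∀ x, (T ^ n) (ψ - T ψ) x ≤ ε := by
  have hpos : ∀ u, 0 ≤ u → 0 ≤ T u := fun u hu =>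
    le_trans (fun x => mul_nonneg hδ0.le (hu x)) (hδ u hu)
  by_contra! hcon
  set w := ψ - T ψ with hw
  let S : Set ℝ := {b | ∃ m, ∀ x, (T ^ m) w x ≤ b}
  have hSb : ∀ b ∈ S, ε ≤ b := by
    rintro b ⟨m, hm⟩
    obtain ⟨x, hx⟩ := hcon m
    exact hx.le.trans (hm x)
  have hTψ : ∀ x, |T ψ x| ≤ C := fun x => by
    have := T_abs_pow T hpos h1 1 ψ 0 C (by simpa using hC) x
    simpa using this
  have hSne : S.Nonempty := ⟨2 * C, 0, fun x => by
    have h1 := abs_le.1 (hC x); have h2 := abs_le.1 (hTψ x)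
    simp [hw]; linarith⟩
  have hbdd : BddBelow S := ⟨ε, hSb⟩
  set b := sInf S with hb
  have hbε : ε ≤ b := le_csInf hSne hSb
  obtain ⟨N, hN⟩ := exists_nat_gt (4 * C / ε)
  have hNε : 4 * C < N * ε := by rwa [div_lt_iff₀ hε] at hN
  set η : ℝ := δ ^ N * ε / 4 with hη
  have hδN : 0 < δ ^ N := pow_pos hδ0 N
  have hη0 : 0 < η := by positivity
  obtain ⟨b', ⟨m, hm⟩, hb'⟩ := exists_lt_of_csInf_lt hSne (show sInf S < b + η by linarith)
  obtain ⟨x, hx⟩ : ∃ x, b - η < (T ^ (N + m)) w x := by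
    by_contra! h
    have : b ≤ b - η := csInf_le hbdd ⟨N + m, h⟩
    linarith
  have hkey : ∀ j ∈ Finset.range N, ε / 2 ≤ (T ^ (j + m)) w x := by
    intro j hj
    have hjN : j ≤ N := (Finset.mem_range.1 hj).le
    set u : X → ℝ := (b + η) • (1 : X → ℝ) - (T ^ m) w with hu
    have hu0 : 0 ≤ u := fun y => by simp [hu]; linarith [hm y]
    have h2 := T_lazy_pow T hδ0 hδ (N - j) ((T ^ j) u) (T_pos_pow T hpos j u hu0) x
    rw [← Module.End.mul_apply, ← pow_add, Nat.sub_add_cancel hjN] at h2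
    have hN' : (T ^ N) u x = (b + η) - (T ^ (N + m)) w x := by
      rw [hu, map_sub, map_smul, T_one_pow T h1, pow_add]; simp
    have hj' : (T ^ j) u x = (b + η) - (T ^ (j + m)) w x := by
      rw [hu, map_sub, map_smul, T_one_pow T h1, pow_add]; simp
    simp only [Pi.smul_apply, smul_eq_mul] at h2
    have hu1 : 0 ≤ (T ^ j) u x := T_pos_pow T hpos j u hu0 x
    have h3 : δ ^ N ≤ δ ^ (N - j) := pow_le_pow_of_le_one hδ0.le hδ1 (Nat.sub_le _ _)
    have h4 : δ ^ N * (T ^ j) u x ≤ 2 * η := by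
      have := mul_le_mul_of_nonneg_right h3 hu1
      linarith
    have h5 : (T ^ j) u x ≤ ε / 2 := by
      rw [hη] at h4
      have : δ ^ N * (T ^ j) u x ≤ δ ^ N * (ε / 2) := by linarith
      exact le_of_mul_le_mul_left this hδN
    linarith
  have hsum := Finset.sum_le_sum hkey
  have htel : ∑ j ∈ Finset.range N, (T ^ (j + m)) w x = (T ^ m) ψ x - (T ^ (N + m)) ψ x := by
    have : ∀ j, (T ^ (j + m)) w x = (T ^ (j + m)) ψ x - (T ^ (j + 1 + m)) ψ x := by
      intro j
      rw [hw, map_sub, show j + 1 + m = (j + m) + 1 by ring, pow_succ T (j + m)]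
      simp
    simp only [this]
    have := Finset.sum_range_sub' (fun j => (T ^ (j + m)) ψ x) N
    simpa using this
  rw [htel] at hsum
  simp at hsum
  have e1 := abs_le.1 (by simpa using T_abs_pow T hpos h1 m ψ 0 C (by simpa using hC) x)
  have e2 := abs_le.1 (by simpa using T_abs_pow T hpos h1 (N + m) ψ 0 C (by simpa using hC) x)
  nlinarith
end abstractop

section opfacts
variable {p : UnitAddCircle → ℝ} {a : UnitAddCircle}

lemma opP_pos (h0 : ∀ x, 0 ≤ p x) (h1 : ∀ x, p x ≤ 1) (u) (hu : 0 ≤ u) : 0 ≤ opP p a u := by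
  intro x
  rw [opP_apply]
  have := mul_nonneg (h0 x) (hu (x + a))
  have := mul_nonneg (sub_nonneg.2 (h1 x)) (hu (x - a))
  simp; linarith

lemma opP_one : opP p a 1 = 1 := by
  ext x; simp [opP_apply]

lemma opP_lazy {d : ℝ} (hd : 0 < d) (h0 : ∀ x, d ≤ p x) (h1 : ∀ x, p x ≤ 1 - d)
    (u) (hu : 0 ≤ u) : (d ^ 2) • u ≤ (opP p a * opP p a) u := by
  intro x
  have hp := opP_pos (p := p) (a := a) (fun x => hd.le.trans (h0 x))
    (fun x => (h1 x).trans (by linarith)) u hu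
  rw [Module.End.mul_apply, opP_apply]
  have e1 := mul_nonneg (sub_nonneg.2 ((h1 x).trans (by linarith : 1 - d ≤ 1))) (hp (x - a))
  have e2 : d * u x ≤ opP p a u (x + a) := by
    rw [opP_apply, add_sub_cancel_right]
    have := mul_nonneg (hd.le.trans (h0 (x + a))) (hu (x + a + a))
    have := mul_le_mul_of_nonneg_right (show d ≤ 1 - p (x + a) by linarith [h1 (x + a)]) (hu x)
    simp at *
    linarith
  have e3 : d * (d * u x) ≤ p x * opP p a u (x + a) :=
    mul_le_mul (h0 x) e2 (mul_nonneg hd.le (hu x)) (hd.le.trans (h0 x))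
  simp at *
  nlinarith

end opfacts
section cob
open Submodule

/-- translation operator `u ↦ u + s • u(·-a)` on complex functions -/
def cobL (a : UnitAddCircle) (s : ℂ) : C(UnitAddCircle, ℂ) →ₗ[ℂ] C(UnitAddCircle, ℂ) where
  toFun u := ⟨fun x => u x + s * u (x - a), by fun_prop⟩
  map_add' u v := by ext x; simp; ring
  map_smul' c u := by ext x; simp; ring

lemma fourier_sub_apply (n : ℤ) (x a : UnitAddCircle) :
    fourier n (x - a) = fourier n x * fourier (-n) a := by
  rw [fourier_apply, fourier_apply, fourier_apply, smul_sub, sub_eq_add_neg,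
    AddCircle.toCircle_add]
  simp

lemma fourier_ne_of_irr {α : ℝ} (hα : Irrational α) {n : ℤ} (hn : n ≠ 0) :
    (fourier n (α : UnitAddCircle)) ^ 2 ≠ (1 : ℂ) := by
  rw [fourier_coe_apply, ← Complex.exp_nat_mul, Ne, Complex.exp_eq_one_iff]
  rintro ⟨k, hk⟩
  have h2 : (2 * Real.pi * Complex.I : ℂ) ≠ 0 := Complex.two_pi_I_ne_zero
  have h3 : ((2 * n * α : ℝ) : ℂ) = ((k : ℝ) : ℂ) := by
    apply mul_right_cancel₀ h2
    rw [show ((k : ℝ) : ℂ) = (k : ℂ) by norm_cast, ← hk]; push_cast; ring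
  have h4 : 2 * n * α = k := by exact_mod_cast h3
  have h5 : Irrational ((2 * n : ℤ) * α) := hα.intCast_mul (by omega)
  exact h5.ne_int k (by push_cast; linarith)

lemma fourier_ne_one {α : ℝ} (hα : Irrational α) {n : ℤ} (hn : n ≠ 0) :
    (fourier n (α : UnitAddCircle)) ≠ (1 : ℂ) := fun h =>
  fourier_ne_of_irr hα hn (by rw [h]; simp)

lemma fourier_ne_neg_one {α : ℝ} (hα : Irrational α) (n : ℤ) :
    (fourier n (α : UnitAddCircle)) ≠ (-1 : ℂ) := fun h => by
  by_cases hn : n = 0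
  · subst hn; rw [fourier_zero] at h; norm_num at h
  · exact fourier_ne_of_irr hα hn (by rw [h]; simp)

lemma cobL_fourier (a : UnitAddCircle) (s : ℂ) (n : ℤ) :
    cobL a s (fourier n) = (1 + s * fourier (-n) a) • (fourier n : C(UnitAddCircle, ℂ)) := by
  ext x
  simp only [cobL, LinearMap.coe_mk, AddHom.coe_mk, ContinuousMap.coe_mk,
    ContinuousMap.smul_apply, smul_eq_mul]
  rw [fourier_sub_apply]; ring

lemma approx_of_le {M : Submodule ℂ C(UnitAddCircle, ℂ)}
    (hM : span ℂ (Set.range (@fourier 1)) ≤ M) (h : C(UnitAddCircle, ℝ)) {ε : ℝ} (hε : 0 < ε) :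
    ∃ v ∈ M, ∀ x, |h x - (v x).re| ≤ ε := by
  have h1 : M.topologicalClosure = ⊤ := by
    rw [eq_top_iff, ← span_fourier_closure_eq_top]
    exact topologicalClosure_mono hM
  have h2 : (⟨fun x => (h x : ℂ), by fun_prop⟩ : C(UnitAddCircle, ℂ)) ∈ closure (M : Set _) := by
    rw [← topologicalClosure_coe, h1]; trivial
  obtain ⟨v, hv, hd⟩ := Metric.mem_closure_iff.1 h2 ε hε
  refine ⟨v, hv, fun x => ?_⟩
  have h3 := (ContinuousMap.dist_apply_le_dist x).trans hd.le
  rw [dist_eq_norm] at h3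
  refine le_trans ?_ h3
  have := Complex.abs_re_le_norm ((h x : ℂ) - v x)
  simpa using this

lemma D2 {α : ℝ} (hα : Irrational α) (h : C(UnitAddCircle, ℝ)) {ε : ℝ} (hε : 0 < ε) :
    ∃ u : C(UnitAddCircle, ℝ), ∀ x, |h x - (u x + u (x - (α : UnitAddCircle)))| ≤ ε := by
  obtain ⟨v, ⟨w, rfl⟩, hv⟩ := approx_of_le (M := LinearMap.range (cobL (α : UnitAddCircle) 1)) (by
    rw [span_le]
    rintro _ ⟨n, rfl⟩
    have hne : (1 + 1 * fourier (-n) (α : UnitAddCircle) : ℂ) ≠ 0 := fun h =>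
      fourier_ne_neg_one hα (-n) (by linear_combination h)
    refine ⟨(1 + 1 * fourier (-n) (α : UnitAddCircle) : ℂ)⁻¹ • fourier n, ?_⟩
    rw [map_smul, cobL_fourier, smul_smul, inv_mul_cancel₀ hne, one_smul]) h hε
  refine ⟨⟨fun x => (w x).re, by fun_prop⟩, fun x => ?_⟩
  simpa [cobL] using hv x

lemma D1aux {α : ℝ} (hα : Irrational α) (h : C(UnitAddCircle, ℝ)) {ε : ℝ} (hε : 0 < ε) :
    ∃ (u : C(UnitAddCircle, ℝ)) (k : ℝ),
      ∀ x, |h x - k - (u x - u (x - (α : UnitAddCircle)))| ≤ ε := by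
  obtain ⟨v, hv', hv⟩ := approx_of_le
    (M := LinearMap.range (cobL (α : UnitAddCircle) (-1)) ⊔ span ℂ {fourier 0}) (by
    rw [span_le]
    rintro _ ⟨n, rfl⟩
    by_cases hn : n = 0
    · subst hn
      exact mem_sup_right (mem_span_singleton_self _)
    apply mem_sup_left
    have hne : (1 + (-1) * fourier (-n) (α : UnitAddCircle) : ℂ) ≠ 0 := fun h =>
      fourier_ne_one hα (neg_ne_zero.2 hn) (by linear_combination -h)
    refine ⟨(1 + (-1) * fourier (-n) (α : UnitAddCircle) : ℂ)⁻¹ • fourier n, ?_⟩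
    rw [map_smul, cobL_fourier, smul_smul, inv_mul_cancel₀ hne, one_smul]) h hε
  obtain ⟨_, ⟨w, rfl⟩, z, hz, rfl⟩ := mem_sup.1 hv'
  obtain ⟨k, rfl⟩ := mem_span_singleton.1 hz
  refine ⟨⟨fun x => (w x).re, by fun_prop⟩, k.re, fun x => ?_⟩
  have := hv x
  simp only [ContinuousMap.add_apply, ContinuousMap.smul_apply, fourier_zero] at this
  simp [cobL] at this
  simp
  convert this using 2
  ring

lemma vol_one : (volume : Measure UnitAddCircle).real Set.univ = 1 := by
  simp [Measure.real, UnitAddCircle.measure_univ]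

lemma int_cont (h : C(UnitAddCircle, ℝ)) : Integrable (fun x => h x) volume :=
  h.continuous.integrable_of_hasCompactSupport (HasCompactSupport.of_compactSpace _)

lemma D1 {α : ℝ} (hα : Irrational α) (h : C(UnitAddCircle, ℝ)) (h0 : ∫ x, h x = 0)
    {ε : ℝ} (hε : 0 < ε) :
    ∃ (u : C(UnitAddCircle, ℝ)),
      ∀ x, |h x - (u x - u (x - (α : UnitAddCircle)))| ≤ ε := by
  obtain ⟨u, k, hu⟩ := D1aux hα h (half_pos hε)
  have iu := int_cont u
  have iu' : Integrable (fun x => u (x - (α : UnitAddCircle))) volume := iu.comp_sub_right _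
  have e : ∫ x, (h x - k - (u x - u (x - (α : UnitAddCircle)))) = -k := by
    have i1 : Integrable (fun x => h x - k) (volume : Measure UnitAddCircle) :=
      (int_cont h).sub (integrable_const k)
    have i2 : Integrable (fun x => u x - u (x - (α : UnitAddCircle)))
      (volume : Measure UnitAddCircle) := iu.sub iu'
    rw [integral_sub i1 i2,
      integral_sub (int_cont h) (integrable_const k), integral_sub iu iu', h0,
      integral_sub_right_eq_self (fun x => u x)]
    simp [vol_one]
  have hk : |k| ≤ ε / 2 := by
    rw [← abs_neg, ← e]
    have := norm_integral_le_of_norm_le_const (μ := (volume : Measure UnitAddCircle))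
      (f := fun x => h x - k - (u x - u (x - (α : UnitAddCircle)))) (C := ε / 2)
      (Eventually.of_forall hu)
    simpa [vol_one] using this
  refine ⟨u, fun x => ?_⟩
  have := abs_le.1 (hu x); have := abs_le.1 hk
  rw [abs_le]; constructor <;> linarith

variable {α : ℝ} (hα : Irrational α) (c : C(UnitAddCircle, ℝ)) (hc : ∀ x, 0 < c x)

include hα hc in
lemma S2 {A B : ℝ} (hA : 0 < A) (hcA : ∀ x, A ≤ c x) (hcB : ∀ x, c x ≤ B)
    (φ : C(UnitAddCircle, ℝ)) {ε : ℝ} (hε : 0 < ε) :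
    ∃ ψ : C(UnitAddCircle, ℝ), ∀ x,
      |φ x - (ψ x + opP (fun x => c x / (c x + c (x - (α : UnitAddCircle)))) α ψ x)| ≤ ε := by
  have hB : 0 < B := hA.trans_le ((hcA 0).trans (hcB 0))
  obtain ⟨u, hu⟩ := D2 hα ⟨fun x => (c x + c (x - (α : UnitAddCircle))) * φ x, by fun_prop⟩
    (show 0 < A * ε by positivity)
  obtain ⟨v, hv⟩ := D2 hα ⟨fun x => u x / c x, by
    exact u.continuous.div₀ c.continuous (fun x => (hc x).ne')⟩
    (show 0 < A * ε / (2 * B) by positivity)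
  refine ⟨⟨fun x => v (x - (α : UnitAddCircle)), by fun_prop⟩, fun x => ?_⟩
  have h1 := abs_le.1 (hu x)
  have h2 : ∀ y, |u y - c y * (v y + v (y - (α : UnitAddCircle)))| ≤ A * ε / 2 := by
    intro y
    have := hv y
    simp only [ContinuousMap.coe_mk] at this
    have e : u y - c y * (v y + v (y - (α : UnitAddCircle))) =
      c y * (u y / c y - (v y + v (y - (α : UnitAddCircle)))) := by
      field_simp [(hc y).ne']
    rw [e, abs_mul, abs_of_pos (hc y)]
    calc c y * _ ≤ B * (A * ε / (2 * B)) := mul_le_mul (hcB y) this (abs_nonneg _) hB.le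
      _ = A * ε / 2 := by field_simp
  have h3 := abs_le.1 (h2 x)
  have h4 := abs_le.1 (h2 (x - (α : UnitAddCircle)))
  have hm : 0 < c x + c (x - (α : UnitAddCircle)) := add_pos (hc _) (hc _)
  simp only [opP_apply, ContinuousMap.coe_mk, add_sub_cancel_right] at *
  set m := c x + c (x - (α : UnitAddCircle)) with hmdef
  have hmA : 2 * A ≤ m := by linarith [hcA x, hcA (x - (α : UnitAddCircle))]
  have e : φ x - (v (x - ↑α) + (c x / m * v x + (1 - c x / m) * v (x - ↑α - ↑α))) =
    (m * φ x - (c x * (v x + v (x - ↑α)) +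
      c (x - ↑α) * (v (x - ↑α) + v (x - ↑α - ↑α)))) / m := by
    field_simp
    rw [hmdef]; ring
  rw [e, abs_div, abs_of_pos hm, div_le_iff₀ hm, abs_le]
  have : ε * (2 * A) ≤ ε * m := mul_le_mul_of_nonneg_left hmA hε.le
  constructor <;> linarith

include hα hc in
lemma S1 {A B : ℝ} (hA : 0 < A) (hcA : ∀ x, A ≤ c x) (hcB : ∀ x, c x ≤ B)
    (φ : C(UnitAddCircle, ℝ)) {ε : ℝ} (hε : 0 < ε) :
    ∃ (ψ : C(UnitAddCircle, ℝ)) (k : ℝ), ∀ x,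
      |φ x - k - (ψ x - opP (fun x => c x / (c x + c (x - (α : UnitAddCircle)))) α ψ x)| ≤ ε := by
  have hB : 0 < B := hA.trans_le ((hcA 0).trans (hcB 0))
  let mm : C(UnitAddCircle, ℝ) := ⟨fun x => c x + c (x - (α : UnitAddCircle)), by fun_prop⟩
  have hmm : ∀ x, 0 < mm x := fun x => add_pos (hc _) (hc _)
  let ci : C(UnitAddCircle, ℝ) := ⟨fun x => (c x)⁻¹, c.continuous.inv₀ (fun x => (hc x).ne')⟩
  have hci : ∀ x, 0 < ci x := fun x => inv_pos.2 (hc x)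
  have key : ∀ (w : C(UnitAddCircle, ℝ)), (∀ x, 0 < w x) → ∀ g : C(UnitAddCircle, ℝ),
      ∃ k : ℝ, ∫ x : UnitAddCircle, (w * (g - ContinuousMap.const UnitAddCircle k)) x = 0 := by
    intro w hw g
    have hpos : 0 < ∫ x, w x := by
      rw [integral_pos_iff_support_of_nonneg (fun x => (hw x).le) (int_cont w)]
      rw [show Function.support (fun x => w x) = Set.univ from
        Set.eq_univ_of_forall fun x => (hw x).ne']
      simp
    refine ⟨(∫ x, (w * g) x) / ∫ x, w x, ?_⟩
    have : ∀ k : ℝ, ∫ x : UnitAddCircle, (w * (g - ContinuousMap.const UnitAddCircle k)) x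
        = ∫ x : UnitAddCircle, (w * g) x - k * w x := by
      intro k; congr 1; ext x; simp; ring
    rw [this, integral_sub (int_cont (w * g)) ((int_cont w).const_mul _), integral_const_mul]
    field_simp
    simp
  obtain ⟨k, hk⟩ := key mm hmm φ
  obtain ⟨u, hu⟩ := D1 hα _ hk (show 0 < A * ε by positivity)
  obtain ⟨s, hs⟩ := key ci hci u
  obtain ⟨v, hv⟩ := D1 hα _ hs (show 0 < A * ε / (2 * B) by positivity)
  refine ⟨⟨fun x => - v (x - (α : UnitAddCircle)), by fun_prop⟩, k, fun x => ?_⟩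
  have h1 := abs_le.1 (hu x)
  have h2 : ∀ y, |u y - s - c y * (v y - v (y - (α : UnitAddCircle)))| ≤ A * ε / 2 := by
    intro y
    have := hv y
    simp only [ContinuousMap.mul_apply, ContinuousMap.sub_apply, ContinuousMap.const_apply, ci,
      ContinuousMap.coe_mk] at this
    have e : u y - s - c y * (v y - v (y - (α : UnitAddCircle))) =
      c y * ((c y)⁻¹ * (u y - s) - (v y - v (y - (α : UnitAddCircle)))) := by
      field_simp [(hc y).ne']
    rw [e, abs_mul, abs_of_pos (hc y)]
    calc c y * _ ≤ B * (A * ε / (2 * B)) := mul_le_mul (hcB y) this (abs_nonneg _) hB.le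
      _ = A * ε / 2 := by field_simp
  have h3 := abs_le.1 (h2 x)
  have h4 := abs_le.1 (h2 (x - (α : UnitAddCircle)))
  have hm : 0 < c x + c (x - (α : UnitAddCircle)) := add_pos (hc _) (hc _)
  simp only [opP_apply, ContinuousMap.coe_mk, add_sub_cancel_right, ContinuousMap.mul_apply,
    ContinuousMap.sub_apply, ContinuousMap.const_apply, mm] at *
  set m := c x + c (x - (α : UnitAddCircle)) with hmdef
  have hmA : 2 * A ≤ m := by linarith [hcA x, hcA (x - (α : UnitAddCircle))]
  have e : φ x - k - (-v (x - ↑α) - (c x / m * -v x + (1 - c x / m) * -v (x - ↑α - ↑α))) =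
    (m * (φ x - k) - (c x * (v x - v (x - ↑α)) -
      c (x - ↑α) * (v (x - ↑α) - v (x - ↑α - ↑α)))) / m := by
    field_simp
    rw [hmdef]; ring
  rw [e, abs_div, abs_of_pos hm, div_le_iff₀ hm, abs_le]
  have : ε * (2 * A) ≤ ε * m := mul_le_mul_of_nonneg_left hmA hε.le
  constructor <;> linarith

include hα hc in
lemma cob_mixing (φ : C(UnitAddCircle, ℝ)) {ε : ℝ} (hε : 0 < ε) :
    ∃ (n : ℕ) (k : ℝ), ∀ x,
      |(opP (fun x => c x / (c x + c (x - (α : UnitAddCircle)))) α ^ n) φ x - k| ≤ ε := by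
  obtain ⟨x0, -, hx0⟩ := isCompact_univ.exists_isMinOn Set.univ_nonempty c.continuous.continuousOn
  obtain ⟨x1, -, hx1⟩ := isCompact_univ.exists_isMaxOn Set.univ_nonempty c.continuous.continuousOn
  have hcA : ∀ x, c x0 ≤ c x := fun x => hx0 (Set.mem_univ x)
  have hcB : ∀ x, c x ≤ c x1 := fun x => hx1 (Set.mem_univ x)
  set p : UnitAddCircle → ℝ := fun x => c x / (c x + c (x - (α : UnitAddCircle))) with hp
  set P := opP p α with hP
  have hA := hc x0
  have hB := hc x1
  set A := c x0
  set B := c x1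
  have hd0 : 0 < A / (2 * B) := by positivity
  have hpd : ∀ x, A / (2 * B) ≤ p x := fun x => by
    rw [hp]
    exact div_le_div₀ (hc x).le (hcA x) (add_pos (hc _) (hc _))
      (by linarith [hcB x, hcB (x - (α : UnitAddCircle))])
  have hpd' : ∀ x, p x ≤ 1 - A / (2 * B) := fun x => by
    have e : 1 - p x = c (x - (α : UnitAddCircle)) / (c x + c (x - (α : UnitAddCircle))) := by
      have := (add_pos (hc x) (hc (x - (α : UnitAddCircle)))).ne'
      rw [hp]; field_simp; ring
    have : A / (2 * B) ≤ 1 - p x := by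
      rw [e]
      exact div_le_div₀ (hc _).le (hcA _) (add_pos (hc _) (hc _))
        (by linarith [hcB x, hcB (x - (α : UnitAddCircle))])
    linarith
  have hpos : ∀ u, 0 ≤ u → 0 ≤ P u := opP_pos (fun x => hd0.le.trans (hpd x))
    (fun x => (hpd' x).trans (by linarith))
  have hone : P 1 = 1 := opP_one
  have hε' : 0 < ε / 8 := by positivity
  obtain ⟨ψ, k, hψ⟩ := S1 hα c hc hA hcA hcB φ hε'
  obtain ⟨η, hη⟩ := S2 hα c hc hA hcA hcB ψ hε'
  rw [← hp, ← hP] at hψ hη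
  have hPP : ∀ u, 0 ≤ u → ((A / (2 * B)) ^ 2) • u ≤ (P * P) u := opP_lazy hd0 hpd hpd'
  have hPP1 : (P * P) 1 = 1 := by rw [Module.End.mul_apply, hone, hone]
  have hPPpos : ∀ u, 0 ≤ u → 0 ≤ (P * P) u := fun u hu => hpos _ (hpos _ hu)
  have hd1 : (A / (2 * B)) ^ 2 ≤ 1 := by
    have : A / (2 * B) ≤ 1 := by linarith [hpd 0, hpd' 0]
    exact pow_le_one₀ hd0.le this
  have hC : ∀ x, |η x| ≤ ‖η‖ := fun x => η.norm_coe_le_norm x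
  obtain ⟨n1, hn1⟩ := lazy_lemma (P * P) (pow_pos hd0 2) hd1 hPP1 hPP η ‖η‖ hC hε'
  obtain ⟨n2, hn2⟩ := lazy_lemma (P * P) (pow_pos hd0 2) hd1 hPP1 hPP (-η) ‖η‖
    (fun x => by simpa using hC x) hε'
  set w : UnitAddCircle → ℝ := η - (P * P) η with hw
  have hw1 : ∀ x, ((P * P) ^ (n1 + n2)) w x ≤ ε / 8 := fun x => by
    rw [add_comm, pow_add]
    exact T_le_pow (P * P) hPPpos hPP1 n2 _ _ hn1 x
  have hw2 : ∀ x, -(ε / 8) ≤ ((P * P) ^ (n1 + n2)) w x := fun x => by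
    rw [pow_add]
    refine T_ge_pow (P * P) hPPpos hPP1 n1 _ _ (fun y => ?_) x
    have := hn2 y
    rw [map_neg, show (-(η : UnitAddCircle → ℝ) - -((P * P) η)) = - w by rw [hw]; abel,
      map_neg] at this
    simp only [Pi.neg_apply] at this
    linarith
  have hφ : ∀ x, |((φ : UnitAddCircle → ℝ) - w) x - k| ≤ 3 * (ε / 8) := by
    intro x
    have e1 := abs_le.1 (hψ x)
    have e2 := abs_le.1 (hη x)
    have e3 := T_abs_pow P hpos hone 1 ((ψ : UnitAddCircle → ℝ) - (η + P η)) 0 (ε / 8)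
      (fun y => by simpa using hη y) x
    rw [pow_one, map_sub, map_add] at e3
    have e3 := abs_le.1 e3
    simp only [hw, Module.End.mul_apply, Pi.sub_apply, Pi.add_apply] at *
    rw [abs_le]; constructor <;> linarith
  refine ⟨2 * (n1 + n2), k, fun x => ?_⟩
  have h5 := T_abs_pow (P * P) hPPpos hPP1 (n1 + n2) _ k _ hφ x
  rw [map_sub] at h5
  rw [pow_mul, pow_two]
  have h5 := abs_le.1 h5
  simp only [Pi.sub_apply] at h5
  have := hw1 x; have := hw2 x
  rw [abs_le]; constructor <;> linarith
end cob
section walk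

lemma pOf_pos (f : UnitAddCircle → ℝ) (x) : 0 < pOf f x := by unfold pOf; positivity
lemma pOf_lt (f : UnitAddCircle → ℝ) (x) : pOf f x < 1 := by
  unfold pOf; rw [div_lt_one (by positivity)]; linarith [Real.exp_pos (f x)]

variable {𝔭 : UnitAddCircle → ℝ} {α : ℝ} {x : UnitAddCircle} {Ω : Type} [MeasurableSpace Ω]
  {ℙ : Measure Ω} {ξ : ℕ → Ω → ℤ}

lemma stepProb_nonneg (h0 : ∀ x, 0 ≤ 𝔭 x) (h1 : ∀ x, 𝔭 x ≤ 1) (j j') :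
    0 ≤ stepProb 𝔭 α x j j' := by
  unfold stepProb
  split_ifs
  · exact h0 _
  · linarith [h1 (pt α x j)]
  · exact le_rfl

lemma walk_joint (hξ : IsQPWalk 𝔭 α x 0 ℙ ξ) (h0 : ∀ x, 0 ≤ 𝔭 x) (h1 : ∀ x, 𝔭 x ≤ 1)
    (n : ℕ) (i j : ℤ) :
    ℙ {ω | ξ n ω = i ∧ ξ (n + 1) ω = j} =
      ENNReal.ofReal (stepProb 𝔭 α x i j) * ℙ {ω | ξ n ω = i} := by
  obtain ⟨hpr, hm, hf⟩ := hξ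
  let path : Ω → (Fin (n + 1) → ℤ) := fun ω i => ξ i ω
  have hpath : Measurable path := measurable_pi_lambda _ fun i => hm i
  have hE : MeasurableSet {ω | ξ n ω = i} := hm n (measurableSet_singleton i)
  have hF : MeasurableSet {ω | ξ n ω = i ∧ ξ (n + 1) ω = j} :=
    hE.inter (hm (n + 1) (measurableSet_singleton j))
  have key : (ℙ.restrict {ω | ξ n ω = i ∧ ξ (n + 1) ω = j}).map path =
      ENNReal.ofReal (stepProb 𝔭 α x i j) • (ℙ.restrict {ω | ξ n ω = i}).map path := by
    rw [Measure.ext_iff_singleton]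
    intro k
    rw [Measure.smul_apply, Measure.map_apply hpath (measurableSet_singleton k),
      Measure.map_apply hpath (measurableSet_singleton k),
      Measure.restrict_apply (hpath (measurableSet_singleton k)),
      Measure.restrict_apply (hpath (measurableSet_singleton k)), smul_eq_mul]
    by_cases hk : k (Fin.last n) = i
    · let k' : ℕ → ℤ := fun m => if hm : m < n + 1 then k ⟨m, hm⟩ else j
      have hk'n : k' n = i := by
        simp only [k']; rw [dif_pos (Nat.lt_succ_self n), ← hk]; rfl
      have hk's : k' (n + 1) = j := by simp [k']
      have hmem : ∀ ω, path ω = k ↔ ∀ m ≤ n, ξ m ω = k' m := by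
        intro ω
        constructor
        · intro h m hmn
          simp only [k']; rw [dif_pos (Nat.lt_succ_of_le hmn), ← h]
        · intro h
          ext m
          have := h m (Nat.lt_succ_iff.1 m.2)
          simp only [k'] at this; rw [dif_pos m.2] at this
          exact this
      have s1 : path ⁻¹' {k} ∩ {ω | ξ n ω = i ∧ ξ (n + 1) ω = j} =
          {ω | ∀ m ≤ n + 1, ξ m ω = k' m} := by
        ext ω
        simp only [Set.mem_inter_iff, Set.mem_preimage, Set.mem_singleton_iff, Set.mem_ofPred_eq,
          hmem]
        constructor
        · rintro ⟨h, -, h3⟩ m hmn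
          rcases Nat.lt_or_ge n m with h4 | h4
          · obtain rfl : m = n + 1 := by omega
            rw [h3, hk's]
          · exact h m h4
        · intro h
          exact ⟨fun m hmn => h m (by omega), by rw [h n (by omega), hk'n],
            by rw [h _ le_rfl, hk's]⟩
      have s2 : path ⁻¹' {k} ∩ {ω | ξ n ω = i} = {ω | ∀ m ≤ n, ξ m ω = k' m} := by
        ext ω
        simp only [Set.mem_inter_iff, Set.mem_preimage, Set.mem_singleton_iff, Set.mem_ofPred_eq,
          hmem]
        constructor
        · rintro ⟨h, -⟩; exact h
        · intro h
          exact ⟨h, by rw [h n le_rfl, hk'n]⟩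
      rw [s1, s2, hf, hf, ← ENNReal.ofReal_mul (stepProb_nonneg h0 h1 _ _),
        Finset.prod_range_succ, hk'n, hk's]
      congr 1; ring
    · have s2 : path ⁻¹' {k} ∩ {ω | ξ n ω = i} = ∅ := by
        ext ω
        simp only [Set.mem_inter_iff, Set.mem_preimage, Set.mem_singleton_iff, Set.mem_ofPred_eq,
          Set.mem_empty_iff_false, iff_false]
        rintro ⟨h, h'⟩
        exact hk (by rw [← h, ← h']; rfl)
      have s1 : path ⁻¹' {k} ∩ {ω | ξ n ω = i ∧ ξ (n + 1) ω = j} = ∅ := by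
        rw [← Set.subset_empty_iff, ← s2]
        exact fun ω h => ⟨h.1, h.2.1⟩
      rw [s1, s2]; simp
  have := congrArg (fun μ => μ Set.univ) key
  simp only [Measure.smul_apply] at this
  rw [Measure.map_apply hpath MeasurableSet.univ, Measure.map_apply hpath MeasurableSet.univ] at this
  simpa using this

lemma walk_step (hξ : IsQPWalk 𝔭 α x 0 ℙ ξ) (h0 : ∀ x, 0 ≤ 𝔭 x) (h1 : ∀ x, 𝔭 x ≤ 1)
    (n : ℕ) (ψ : ℤ → ENNReal) :
    ∫⁻ ω, ψ (ξ (n + 1) ω) ∂ℙ = ∫⁻ ω, (ENNReal.ofReal (𝔭 (pt α x (ξ n ω))) * ψ (ξ n ω + 1) +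
      ENNReal.ofReal (1 - 𝔭 (pt α x (ξ n ω))) * ψ (ξ n ω - 1)) ∂ℙ := by
  have hm := hξ.2.1
  have hpair : Measurable (fun ω => (ξ n ω, ξ (n + 1) ω)) := (hm n).prodMk (hm (n + 1))
  have e1 : ∫⁻ ω, ψ (ξ (n + 1) ω) ∂ℙ =
      ∫⁻ z : ℤ × ℤ, ψ z.2 ∂(ℙ.map (fun ω => (ξ n ω, ξ (n + 1) ω))) := by
    rw [lintegral_map (measurable_of_countable _) hpair]
  have e2 : ∫⁻ ω, (ENNReal.ofReal (𝔭 (pt α x (ξ n ω))) * ψ (ξ n ω + 1) +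
      ENNReal.ofReal (1 - 𝔭 (pt α x (ξ n ω))) * ψ (ξ n ω - 1)) ∂ℙ =
      ∫⁻ i : ℤ, (ENNReal.ofReal (𝔭 (pt α x i)) * ψ (i + 1) +
      ENNReal.ofReal (1 - 𝔭 (pt α x i)) * ψ (i - 1)) ∂(ℙ.map (ξ n)) := by
    rw [lintegral_map (measurable_of_countable _) (hm n)]
  rw [e1, e2, lintegral_countable', lintegral_countable', ENNReal.tsum_prod']
  congr 1; ext i
  have e3 : ∀ j, (ℙ.map (fun ω => (ξ n ω, ξ (n + 1) ω))) {(i, j)} =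
      ENNReal.ofReal (stepProb 𝔭 α x i j) * (ℙ.map (ξ n)) {i} := by
    intro j
    rw [Measure.map_apply hpair (measurableSet_singleton _),
      Measure.map_apply (hm n) (measurableSet_singleton _)]
    have e : (fun ω => (ξ n ω, ξ (n + 1) ω)) ⁻¹' {(i, j)} =
        {ω | ξ n ω = i ∧ ξ (n + 1) ω = j} := by ext ω; simp
    rw [e]
    exact walk_joint hξ h0 h1 n i j
  simp only [e3]
  have e4 : ∀ j ∉ ({i + 1, i - 1} : Finset ℤ),
      ψ j * (ENNReal.ofReal (stepProb 𝔭 α x i j) * (ℙ.map (ξ n)) {i}) = 0 := by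
    intro j hj
    simp only [Finset.mem_insert, Finset.mem_singleton, not_or] at hj
    simp [stepProb, hj.1, hj.2]
  rw [tsum_eq_sum e4, Finset.sum_pair (by omega)]
  have s1 : stepProb 𝔭 α x i (i + 1) = 𝔭 (pt α x i) := by simp [stepProb]
  have s2 : stepProb 𝔭 α x i (i - 1) = 1 - 𝔭 (pt α x i) := by
    unfold stepProb; rw [if_neg (by omega), if_pos rfl]
  rw [s1, s2]; ring

lemma pt_succ (i : ℤ) : pt α x (i + 1) = pt α x i + (α : UnitAddCircle) := by
  unfold pt; rw [add_assoc]; congr 1; rw [← AddCircle.coe_add]; congr 1; push_cast; ring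

lemma pt_pred (i : ℤ) : pt α x (i - 1) = pt α x i - (α : UnitAddCircle) := by
  rw [eq_sub_iff_add_eq, ← pt_succ]; congr 1; ring

lemma walk_lint (hξ : IsQPWalk 𝔭 α x 0 ℙ ξ) (h0 : ∀ x, 0 ≤ 𝔭 x) (h1 : ∀ x, 𝔭 x ≤ 1)
    (n : ℕ) (φ : UnitAddCircle → ℝ) (hφ : 0 ≤ φ) :
    ∫⁻ ω, ENNReal.ofReal (φ (pt α x (ξ n ω))) ∂ℙ =
      ENNReal.ofReal ((opP 𝔭 α ^ n) φ x) := by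
  induction n generalizing φ with
  | zero =>
    have hpr := hξ.1
    have h := hξ.2.2 0 (fun _ => 0)
    simp at h
    have hae : ∀ᵐ ω ∂ℙ, ξ 0 ω = 0 := by
      have h' : ℙ (ξ 0 ⁻¹' {0}) = 1 := h
      rw [← prob_compl_eq_zero_iff (hξ.2.1 0 (measurableSet_singleton 0))] at h'
      exact h'
    rw [lintegral_congr_ae (g := fun _ => ENNReal.ofReal (φ x))]
    · simp
    · filter_upwards [hae] with ω hω
      rw [hω]; simp [pt]
  | succ n ih =>
    have hP : 0 ≤ opP 𝔭 α φ := opP_pos h0 h1 φ hφ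
    rw [walk_step hξ h0 h1 n (fun i => ENNReal.ofReal (φ (pt α x i))), pow_succ,
      Module.End.mul_apply, ← ih _ hP]
    congr 1; ext ω
    rw [opP_apply, ENNReal.ofReal_add (mul_nonneg (h0 _) (hφ _))
      (mul_nonneg (sub_nonneg.2 (h1 _)) (hφ _)), ENNReal.ofReal_mul (h0 _),
      ENNReal.ofReal_mul (sub_nonneg.2 (h1 _)), pt_succ, pt_pred]

lemma walk_int (hξ : IsQPWalk 𝔭 α x 0 ℙ ξ) (h0 : ∀ x, 0 ≤ 𝔭 x) (h1 : ∀ x, 𝔭 x ≤ 1)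
    (n : ℕ) (φ : C(UnitAddCircle, ℝ)) :
    ∫ ω, φ (pt α x (ξ n ω)) ∂ℙ = (opP 𝔭 α ^ n) φ x := by
  have hpr := hξ.1
  have hm : Measurable fun ω => pt α x (ξ n ω) :=
    (measurable_of_countable (fun i : ℤ => pt α x i)).comp (hξ.2.1 n)
  have hint : Integrable (fun ω => φ (pt α x (ξ n ω))) ℙ := by
    refine Integrable.of_bound (C := ‖φ‖) ?_ (Eventually.of_forall fun ω => φ.norm_coe_le_norm _)
    exact (φ.continuous.measurable.comp hm).aestronglyMeasurable
  have hφ : 0 ≤ (φ : UnitAddCircle → ℝ) + ‖φ‖ • (1 : UnitAddCircle → ℝ) := fun y => by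
    have := abs_le.1 (φ.norm_coe_le_norm y)
    simp; linarith
  have h := walk_lint hξ h0 h1 n _ hφ
  rw [map_add, map_smul, T_one_pow _ opP_one] at h
  have h' := congrArg ENNReal.toReal h
  rw [← integral_eq_lintegral_of_nonneg_ae (f := fun ω =>
      ((φ : UnitAddCircle → ℝ) + ‖φ‖ • (1 : UnitAddCircle → ℝ)) (pt α x (ξ n ω)))
      (Eventually.of_forall fun ω => hφ _),
    ENNReal.toReal_ofReal] at h'
  · simp only [Pi.add_apply, Pi.smul_apply, Pi.one_apply, smul_eq_mul, mul_one] at h'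
    rw [integral_add hint (integrable_const _)] at h'
    simpa using h'
  · have := T_pos_pow (opP 𝔭 α) (opP_pos h0 h1) n _ hφ x
    rwa [map_add, map_smul, T_one_pow _ opP_one] at this
  · exact ((φ.continuous.measurable.comp hm).add_const (‖φ‖ • 1)).aestronglyMeasurable
end walk

section lim
variable {p : UnitAddCircle → ℝ} {a : UnitAddCircle}

lemma exists_law (h0 : ∀ x, 0 ≤ p x) (h1 : ∀ x, p x ≤ 1) (n : ℕ) (x : UnitAddCircle) :
    ∃ μ : ProbabilityMeasure UnitAddCircle, ∀ φ : C(UnitAddCircle, ℝ),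
      ∫ z, φ z ∂(μ : Measure UnitAddCircle) = (opP p a ^ n) φ x := by
  induction n generalizing x with
  | zero => exact ⟨⟨Measure.dirac x, inferInstance⟩, fun φ => by simp⟩
  | succ n ih =>
    obtain ⟨μ1, hμ1⟩ := ih (x + a)
    obtain ⟨μ2, hμ2⟩ := ih (x - a)
    refine ⟨⟨ENNReal.ofReal (p x) • (μ1 : Measure UnitAddCircle) +
      ENNReal.ofReal (1 - p x) • (μ2 : Measure UnitAddCircle), ⟨?_⟩⟩, fun φ => ?_⟩
    · simp only [Measure.add_apply, Measure.smul_apply, measure_univ, smul_eq_mul, mul_one]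
      rw [← ENNReal.ofReal_add (h0 x) (sub_nonneg.2 (h1 x))]; simp
    · have hi : ∀ μ : ProbabilityMeasure UnitAddCircle,
          Integrable (fun z => φ z) (μ : Measure UnitAddCircle) := fun μ =>
        φ.continuous.integrable_of_hasCompactSupport (HasCompactSupport.of_compactSpace _)
      simp only [ProbabilityMeasure.coe_mk]
      rw [integral_add_measure ((hi μ1).smul_measure (by simp)) ((hi μ2).smul_measure (by simp)),
        integral_smul_measure, integral_smul_measure, hμ1, hμ2, pow_succ', Module.End.mul_apply,
        opP_apply, ENNReal.toReal_ofReal (h0 x), ENNReal.toReal_ofReal (sub_nonneg.2 (h1 x))]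
      rfl

lemma mixing_of {f : UnitAddCircle → ℝ} {α : ℝ}
    (h : ∀ φ : C(UnitAddCircle, ℝ), ∀ ε > 0, ∃ (n : ℕ) (k : ℝ), ∀ x,
      |(opP (pOf f) α ^ n) φ x - k| ≤ ε) : Mixing (pOf f) α := by
  have h0 : ∀ x, 0 ≤ pOf f x := fun x => (pOf_pos f x).le
  have h1 : ∀ x, pOf f x ≤ 1 := fun x => (pOf_lt f x).le
  choose μ hμ using fun n => exists_law (a := (α : UnitAddCircle)) h0 h1 n 0
  obtain ⟨ν, -, hν⟩ := (isCompact_univ (X := ProbabilityMeasure UnitAddCircle)).ultrafilter_le_nhds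
    ((hyperfilter ℕ).map μ) (by simp)
  have hν' : Tendsto μ (hyperfilter ℕ) (nhds ν) := hν
  rw [ProbabilityMeasure.tendsto_iff_forall_integral_tendsto] at hν'
  refine ⟨ν, inferInstance, fun x Ω _ ℙ ξ hξ φ => ?_⟩
  simp only [walk_int hξ h0 h1]
  have hstay : ∀ ε > 0, ∃ (n : ℕ) (k : ℝ), ∀ m ≥ n, ∀ x,
      |(opP (pOf f) α ^ m) φ x - k| ≤ ε := by
    intro ε hε
    obtain ⟨n, k, hn⟩ := h φ ε hε
    refine ⟨n, k, fun m hm x => ?_⟩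
    obtain ⟨j, rfl⟩ := Nat.exists_eq_add_of_le' hm
    rw [pow_add]
    exact T_abs_pow _ (opP_pos h0 h1) opP_one j _ k ε hn x
  rw [Metric.tendsto_atTop]
  intro ε hε
  obtain ⟨n, k, hn⟩ := hstay (ε / 4) (by positivity)
  have hlim : |∫ z, φ z ∂(ν : Measure UnitAddCircle) - k| ≤ ε / 4 := by
    have ht := hν' (BoundedContinuousFunction.mkOfCompact φ)
    simp only [BoundedContinuousFunction.mkOfCompact_apply, hμ] at ht
    refine le_of_tendsto ((ht.sub_const k).abs) ?_
    have : ∀ᶠ m in atTop, |(opP (pOf f) α ^ m) φ 0 - k| ≤ ε / 4 :=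
      (eventually_ge_atTop n).mono fun m hm => hn m hm 0
    exact (Nat.hyperfilter_le_atTop) this
  refine ⟨n, fun m hm => ?_⟩
  have e1 := abs_le.1 (hn m hm x)
  have e2 := abs_le.1 hlim
  rw [Real.dist_eq, abs_lt]
  constructor <;> linarith

lemma opP_close {p q : UnitAddCircle → ℝ} {a : UnitAddCircle} (h0 : ∀ x, 0 ≤ p x)
    (h1 : ∀ x, p x ≤ 1) (h0' : ∀ x, 0 ≤ q x) (h1' : ∀ x, q x ≤ 1) {r C : ℝ}
    (hpq : ∀ x, |p x - q x| ≤ r)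
    (φ : UnitAddCircle → ℝ) (hφ : ∀ x, |φ x| ≤ C) (n : ℕ) (x : UnitAddCircle) :
    |(opP p a ^ n) φ x - (opP q a ^ n) φ x| ≤ n * (2 * C * r) := by
  induction n generalizing x with
  | zero => simp
  | succ n ih =>
    have hC : ∀ y, |(opP q a ^ n) φ y| ≤ C := fun y => by
      have := T_abs_pow (opP q a) (opP_pos h0' h1') opP_one n φ 0 C (by simpa using hφ) y
      simpa using this
    rw [pow_succ', pow_succ', Module.End.mul_apply, Module.End.mul_apply, opP_apply, opP_apply]
    set u := (opP p a ^ n) φ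
    set v := (opP q a ^ n) φ
    have e : p x * u (x + a) + (1 - p x) * u (x - a) - (q x * v (x + a) + (1 - q x) * v (x - a))
      = p x * (u (x + a) - v (x + a)) + (1 - p x) * (u (x - a) - v (x - a)) +
        (p x - q x) * (v (x + a) - v (x - a)) := by ring
    rw [e]
    have b1 : |p x * (u (x + a) - v (x + a))| ≤ p x * (n * (2 * C * r)) := by
      rw [abs_mul, abs_of_nonneg (h0 x)]
      exact mul_le_mul_of_nonneg_left (ih _) (h0 x)
    have b2 : |(1 - p x) * (u (x - a) - v (x - a))| ≤ (1 - p x) * (n * (2 * C * r)) := by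
      rw [abs_mul, abs_of_nonneg (sub_nonneg.2 (h1 x))]
      exact mul_le_mul_of_nonneg_left (ih _) (sub_nonneg.2 (h1 x))
    have b3 : |(p x - q x) * (v (x + a) - v (x - a))| ≤ r * (2 * C) := by
      rw [abs_mul]
      refine mul_le_mul (hpq x) ?_ (abs_nonneg _) ((abs_nonneg _).trans (hpq x))
      have := abs_sub (v (x + a)) (v (x - a))
      linarith [hC (x + a), hC (x - a)]
    refine (abs_add_three _ _ _).trans ?_
    push_cast
    nlinarith

lemma pOf_close (f g : UnitAddCircle → ℝ) (x) : |pOf f x - pOf g x| ≤ |f x - g x| := by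
  wlog h : g x ≤ f x generalizing f g
  · rw [abs_sub_comm, abs_sub_comm (f x)]
    exact this g f (le_of_not_ge h)
  unfold pOf
  have hE : Real.exp (g x) ≤ Real.exp (f x) := Real.exp_le_exp.2 h
  set E := Real.exp (f x)
  have hd : Real.exp (g x) = E * Real.exp (-(f x - g x)) := by
    rw [← Real.exp_add]; congr 1; ring
  have hd' := Real.add_one_le_exp (-(f x - g x))
  have hE0 : 0 < E := Real.exp_pos _
  have hG0 : 0 < Real.exp (g x) := Real.exp_pos _
  have e : E / (1 + E) - Real.exp (g x) / (1 + Real.exp (g x)) =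
    (E - Real.exp (g x)) / ((1 + E) * (1 + Real.exp (g x))) := by field_simp; ring
  rw [e, abs_of_nonneg (div_nonneg (by linarith) (by positivity)),
    abs_of_nonneg (by linarith : 0 ≤ f x - g x), div_le_iff₀ (by positivity)]
  have h3 : E - Real.exp (g x) ≤ E * (f x - g x) := by rw [hd]; nlinarith
  have h4 : 0 ≤ f x - g x := by linarith
  have h5 : E ≤ (1 + E) * (1 + Real.exp (g x)) := by nlinarith
  nlinarith [mul_le_mul_of_nonneg_right h5 h4]

lemma abs_le_bvNorm {f : UnitAddCircle → ℝ} (hf : Continuous f) (x) : |f x| ≤ bvNorm f := by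
  unfold bvNorm
  have hb : BddAbove (Set.range fun x => |f x|) := by
    have := isCompact_univ.image (f := fun x => |f x|) (by fun_prop)
    rw [Set.image_univ] at this
    exact this.bddAbove
  have := le_ciSup hb x
  have h2 : 0 ≤ (eVariationOn (fun t : ℝ => f (t : UnitAddCircle)) (Set.Icc 0 1)).toReal :=
    ENNReal.toReal_nonneg
  linarith
end lim
section approx
open Submodule

lemma L1approx (d : ℝ → ℝ) (hd : IntervalIntegrable d volume 0 1) {ε : ℝ} (hε : 0 < ε) :
    ∃ T ∈ span ℂ (Set.range (@fourier 1)),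
      ∫ t in (0 : ℝ)..1, |d t - (T (t : UnitAddCircle)).re| ≤ ε := by
  have hd1 : MemLp (fun t => (d t : ℂ)) 1 (volume.restrict (Set.Ioc (0 : ℝ) (0 + 1))) := by
    rw [memLp_one_iff_integrable, zero_add]
    exact ((intervalIntegrable_iff_integrableOn_Ioc_of_le zero_le_one).1 hd).ofReal
  have hD := memLp_haarAddCircle_iff.2 hd1.memLp_liftIoc
  set D := AddCircle.liftIoc (1 : ℝ) 0 (fun t => (d t : ℂ)) with hDdef
  have hmem : hD.toLp D ∈ closure
      ((span ℂ (Set.range (@fourierLp 1 _ 1 _)) : Submodule ℂ _) : Set (Lp ℂ 1 _)) := by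
    rw [← topologicalClosure_coe, span_fourierLp_closure_eq_top (by simp)]; trivial
  obtain ⟨v, hv, hdv⟩ := Metric.mem_closure_iff.1 hmem ε hε
  have hspan : span ℂ (Set.range (@fourierLp 1 _ 1 _)) =
      (span ℂ (Set.range (@fourier 1))).map
        (ContinuousMap.toLp (E := ℂ) 1 (@AddCircle.haarAddCircle 1 _) ℂ).toLinearMap := by
    rw [map_span, ← Set.range_comp]; rfl
  rw [hspan] at hv
  obtain ⟨T, hT, rfl⟩ := hv
  refine ⟨T, hT, ?_⟩
  have hTm : MemLp T 1 (@AddCircle.haarAddCircle 1 _) := by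
    rw [memLp_one_iff_integrable]
    exact T.continuous.integrable_of_hasCompactSupport (HasCompactSupport.of_compactSpace _)
  have e1 : ∫ z, ‖D z - T z‖ ∂(@AddCircle.haarAddCircle 1 _) ≤ ε := by
    have : dist (hD.toLp D) (ContinuousMap.toLp (E := ℂ) 1 (@AddCircle.haarAddCircle 1 _) ℂ T) =
        ∫ z, ‖D z - T z‖ ∂(@AddCircle.haarAddCircle 1 _) := by
      rw [dist_eq_norm, L1.norm_eq_integral_norm]
      apply integral_congr_ae
      filter_upwards [Lp.coeFn_sub (hD.toLp D)
        (ContinuousMap.toLp (E := ℂ) 1 (@AddCircle.haarAddCircle 1 _) ℂ T), hD.coeFn_toLp,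
        ContinuousMap.coeFn_toLp (𝕜 := ℂ) (p := 1) (@AddCircle.haarAddCircle 1 _) T]
        with z h1 h2 h3
      rw [h1, Pi.sub_apply, h2, h3]
    rw [← this]; exact hdv.le
  rw [AddCircle.integral_haarAddCircle, inv_one, one_smul,
    ← AddCircle.intervalIntegral_preimage 1 0, zero_add] at e1
  refine le_trans ?_ e1
  have e2 : ∫ t in (0 : ℝ)..1, ‖D t - T t‖ =
      ∫ t in (0 : ℝ)..1, ‖(d t : ℂ) - T (t : UnitAddCircle)‖ := by
    apply intervalIntegral.integral_congr_ae
    refine Eventually.of_forall fun x hx => ?_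
    rw [Set.uIoc_of_le zero_le_one] at hx
    rw [hDdef, AddCircle.liftIoc_coe_apply (by simpa using hx)]
  rw [e2]
  have hTi : IntervalIntegrable (fun t : ℝ => T (t : UnitAddCircle)) volume 0 1 :=
    Continuous.intervalIntegrable (T.continuous.comp (AddCircle.continuous_mk' 1)) _ _
  have hTr : IntervalIntegrable (fun t : ℝ => (T (t : UnitAddCircle)).re) volume 0 1 :=
    Continuous.intervalIntegrable
      (Complex.continuous_re.comp (T.continuous.comp (AddCircle.continuous_mk' 1))) _ _
  have hdc : IntervalIntegrable (fun t : ℝ => (d t : ℂ)) volume 0 1 := by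
    rw [intervalIntegrable_iff_integrableOn_Ioc_of_le zero_le_one] at hd ⊢
    exact hd.ofReal
  refine intervalIntegral.integral_mono_on zero_le_one (hd.sub hTr).abs (hdc.sub hTi).norm ?_
  intro t _
  have := Complex.abs_re_le_norm ((d t : ℂ) - T (t : UnitAddCircle))
  simpa using this

lemma trig_prim {α : ℝ} (hα : Irrational α) (T : C(UnitAddCircle, ℂ))
    (hT : T ∈ span ℂ (Set.range (@fourier 1))) :
    ∃ (g : C(UnitAddCircle, ℂ)) (k : ℂ), ∀ t : ℝ,
      HasDerivAt (fun t : ℝ => g (t : UnitAddCircle) - g ((t : UnitAddCircle) - α))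
        (T (t : UnitAddCircle) - k) t := by
  induction hT using span_induction with
  | mem T hT =>
    obtain ⟨n, rfl⟩ := hT
    by_cases hn : n = 0
    · subst hn
      refine ⟨0, 1, fun t => ?_⟩
      rw [fourier_zero]
      simpa using hasDerivAt_const t (0 : ℂ)
    · have hne : (1 - fourier (-n) (α : UnitAddCircle) : ℂ) ≠ 0 := fun h =>
        fourier_ne_one hα (neg_ne_zero.2 hn) (by linear_combination -h)
      have hn' : (2 * Real.pi * Complex.I * n : ℂ) ≠ 0 :=
        mul_ne_zero Complex.two_pi_I_ne_zero (by exact_mod_cast hn)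
      refine ⟨((1 - fourier (-n) (α : UnitAddCircle) : ℂ)⁻¹ * (2 * Real.pi * Complex.I * n)⁻¹) •
        fourier n, 0, fun t => ?_⟩
      have h := (hasDerivAt_fourier 1 n t).const_mul (2 * Real.pi * Complex.I * n : ℂ)⁻¹
      have e : (fun t : ℝ => (((1 - fourier (-n) (α : UnitAddCircle) : ℂ)⁻¹ *
          (2 * Real.pi * Complex.I * n)⁻¹) • (fourier n : C(UnitAddCircle, ℂ))) (t : UnitAddCircle) -
          (((1 - fourier (-n) (α : UnitAddCircle) : ℂ)⁻¹ *
          (2 * Real.pi * Complex.I * n)⁻¹) • (fourier n : C(UnitAddCircle, ℂ)))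
            ((t : UnitAddCircle) - α)) =
          fun t : ℝ => (2 * Real.pi * Complex.I * n : ℂ)⁻¹ * fourier n (t : UnitAddCircle) := by
        ext t
        simp only [ContinuousMap.smul_apply, smul_eq_mul]
        rw [fourier_sub_apply]
        generalize (2 * Real.pi * Complex.I * n : ℂ)⁻¹ = q
        generalize fourier (-n) (α : UnitAddCircle) = r at *
        field_simp
      rw [e]
      convert! h using 1
      generalize (2 * Real.pi * Complex.I * n : ℂ) = q at *
      push_cast
      field_simp
      simp
  | zero => exact ⟨0, 0, fun t => by simpa using hasDerivAt_const t (0 : ℂ)⟩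
  | add T1 T2 _ _ h1 h2 =>
    obtain ⟨g1, k1, h1⟩ := h1
    obtain ⟨g2, k2, h2⟩ := h2
    refine ⟨g1 + g2, k1 + k2, fun t => ?_⟩
    convert! (h1 t).add (h2 t) using 1
    · ext t; simp; ring
    · simp; ring
  | smul c T _ h =>
    obtain ⟨g, k, h⟩ := h
    refine ⟨c • g, c * k, fun t => ?_⟩
    convert! (h t).const_mul c using 1
    · ext t; simp; ring
    · simp; ring

lemma AC_of (F : ℝ → ℝ) (hF : AbsolutelyContinuousOn01 F) :
    AbsolutelyContinuousOnInterval F 0 1 := by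
  rw [absolutelyContinuousOnInterval_iff]
  intro ε hε
  obtain ⟨δ, hδ, h⟩ := hF ε hε
  refine ⟨δ, hδ, ?_⟩
  rintro ⟨n, I⟩ ⟨hI, hdis⟩ hsum
  simp only at *
  have := h n (fun i => min (I i).1 (I i).2) (fun i => max (I i).1 (I i).2) ?_ ?_ ?_
  · rw [Finset.sum_range]
    refine lt_of_eq_of_lt (Finset.sum_congr rfl fun i _ => ?_) this
    rw [Real.dist_eq]
    rcases le_total (I i).1 (I i).2 with h | h
    · rw [min_eq_left h, max_eq_right h, abs_sub_comm]
    · rw [min_eq_right h, max_eq_left h]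
  · intro i
    have := hI i (Finset.mem_range.2 i.2)
    rw [Set.uIcc_of_le zero_le_one] at this
    obtain ⟨⟨a1, a2⟩, b1, b2⟩ := this
    exact ⟨⟨le_min a1 b1, (min_le_left _ _).trans a2⟩, ⟨a1.trans (le_max_left _ _), max_le a2 b2⟩,
      min_le_max⟩
  · intro i j hij
    have := hdis (Finset.mem_coe.2 (Finset.mem_range.2 i.2))
      (Finset.mem_coe.2 (Finset.mem_range.2 j.2)) (fun h => hij (Fin.ext h))
    exact Set.disjoint_of_subset Set.Ioo_subset_Ioc_self Set.Ioo_subset_Ioc_self this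
  · rw [Finset.sum_range] at hsum
    refine lt_of_eq_of_lt (Finset.sum_congr rfl fun i _ => ?_) hsum
    rw [Real.dist_eq, max_sub_min_eq_abs, abs_sub_comm]

lemma AC_lip (F : ℝ → ℝ) (K : ℝ) (hK : 0 ≤ K) (h : ∀ a b, |F b - F a| ≤ K * |b - a|) :
    AbsolutelyContinuousOn01 F := by
  intro ε hε
  refine ⟨ε / (K + 1), by positivity, fun n a b hab _ hsum => ?_⟩
  have h1 : ∑ i, |F (b i) - F (a i)| ≤ K * ∑ i, (b i - a i) := by
    rw [Finset.mul_sum]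
    refine Finset.sum_le_sum fun i _ => (h _ _).trans_eq ?_
    rw [abs_of_nonneg (sub_nonneg.2 (hab i).2.2)]
  have h2 : 0 ≤ ∑ i, (b i - a i) := Finset.sum_nonneg fun i _ => sub_nonneg.2 (hab i).2.2
  rw [lt_div_iff₀ (by positivity)] at hsum
  rcases h2.eq_or_lt with h3 | h3
  · rw [← h3] at h1; simp at h1; linarith
  · nlinarith

lemma var_le (H h : ℝ → ℝ) (hi : IntervalIntegrable h volume 0 1)
    (hH : ∀ a ∈ Set.Icc (0 : ℝ) 1, ∀ b ∈ Set.Icc (0 : ℝ) 1, H b - H a = ∫ t in a..b, h t) :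
    eVariationOn H (Set.Icc 0 1) ≤ ENNReal.ofReal (∫ t in (0 : ℝ)..1, |h t|) := by
  have hii : ∀ a ∈ Set.Icc (0 : ℝ) 1, ∀ b ∈ Set.Icc (0 : ℝ) 1,
      IntervalIntegrable (fun t => |h t|) volume a b := fun a ha b hb =>
    (hi.mono_set (by
      rw [Set.uIcc_of_le (zero_le_one (α := ℝ))]; exact Set.uIcc_subset_Icc ha hb)).abs
  unfold eVariationOn
  refine iSup_le ?_
  rintro ⟨n, u, hu, hus⟩
  simp only
  calc ∑ i ∈ Finset.range n, edist (H (u (i + 1))) (H (u i))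
      ≤ ∑ i ∈ Finset.range n, ENNReal.ofReal (∫ t in (u i)..(u (i + 1)), |h t|) := by
        refine Finset.sum_le_sum fun i _ => ?_
        rw [edist_dist, Real.dist_eq, hH _ (hus i) _ (hus (i + 1))]
        exact ENNReal.ofReal_le_ofReal
          (intervalIntegral.abs_integral_le_integral_abs (hu (Nat.le_succ i)))
    _ = ENNReal.ofReal (∑ i ∈ Finset.range n, ∫ t in (u i)..(u (i + 1)), |h t|) := by
        rw [ENNReal.ofReal_sum_of_nonneg]
        exact fun i _ => intervalIntegral.integral_nonneg (hu (Nat.le_succ i))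
          fun t _ => abs_nonneg _
    _ ≤ _ := by
        apply ENNReal.ofReal_le_ofReal
        rw [intervalIntegral.sum_integral_adjacent_intervals
          (fun i _ => hii _ (hus i) _ (hus (i + 1)))]
        exact intervalIntegral.integral_mono_interval (hus 0).1 (hu (Nat.zero_le n)) (hus n).2
          (Eventually.of_forall fun t => abs_nonneg _) (hii 0 (by simp) 1 (by simp))

lemma approxP {α : ℝ} (hα : Irrational α) (f : UnitAddCircle → ℝ) (hf : memP f) {ε : ℝ}
    (hε : 0 < ε) : ∃ g : C(UnitAddCircle, ℝ),
      memP (fun z => g z - g (z - (α : UnitAddCircle))) ∧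
      bvNorm (fun z => f z - (g z - g (z - (α : UnitAddCircle)))) < ε := by
  obtain ⟨hfc, hfac, hf0⟩ := hf
  set F : ℝ → ℝ := fun t => f (t : UnitAddCircle) with hF
  have hac := AC_of F hfac
  have hdi := hac.intervalIntegrable_deriv
  obtain ⟨T, hT, hTε⟩ := L1approx (deriv F) hdi (show 0 < ε / 5 by positivity)
  obtain ⟨gc, k, hg⟩ := trig_prim hα T hT
  let g : C(UnitAddCircle, ℝ) := ⟨fun z => (gc z).re, by fun_prop⟩
  let G : UnitAddCircle → ℝ := fun z => g z - g (z - (α : UnitAddCircle))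
  have hGc : Continuous G := by fun_prop
  have hG' : ∀ t : ℝ, HasDerivAt (fun t : ℝ => G (t : UnitAddCircle))
      ((T (t : UnitAddCircle)).re - k.re) t := by
    intro t
    have := (Complex.reCLM.hasFDerivAt.comp_hasDerivAt t (hg t))
    simpa [G, g, Function.comp_def] using this
  have hTc : Continuous fun t : ℝ => (T (t : UnitAddCircle)).re - k.re :=
    (Complex.continuous_re.comp (T.continuous.comp (AddCircle.continuous_mk' 1))).sub
      continuous_const
  have hGac : AbsolutelyContinuousOn01 (fun t : ℝ => G (t : UnitAddCircle)) := by
    refine AC_lip _ (‖T‖ + ‖k‖) (by positivity) fun a b => ?_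
    have := (convex_univ (𝕜 := ℝ) (E := ℝ)).norm_image_sub_le_of_norm_hasDerivWithin_le
      (f := fun t : ℝ => G (t : UnitAddCircle)) (C := ‖T‖ + ‖k‖) (x := a) (y := b)
      (fun t _ => (hG' t).hasDerivWithinAt) (fun t _ => by
        have h1 := (Complex.abs_re_le_norm (T (t : UnitAddCircle))).trans
          (T.norm_coe_le_norm _)
        have h2 := Complex.abs_re_le_norm k
        exact (norm_sub_le _ _).trans (add_le_add h1 h2)) trivial trivial
    simpa using this
  have iG : Integrable G (volume : Measure UnitAddCircle) := int_cont ⟨G, hGc⟩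
  have hG0 : ∫ z : UnitAddCircle, G z = 0 := by
    have iu := int_cont g
    have iu' : Integrable (fun x => g (x - (α : UnitAddCircle))) volume := iu.comp_sub_right _
    change ∫ z : UnitAddCircle, (g z - g (z - (α : UnitAddCircle))) = 0
    rw [integral_sub iu iu', integral_sub_right_eq_self (fun x => g x), sub_self]
  refine ⟨g, ⟨hGc, hGac, hG0⟩, ?_⟩
  set h : ℝ → ℝ := fun t => deriv F t - ((T (t : UnitAddCircle)).re - k.re) with hh
  have hTi : ∀ a b, IntervalIntegrable (fun t : ℝ => (T (t : UnitAddCircle)).re - k.re)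
    volume a b := fun a b => hTc.intervalIntegrable a b
  have hhi : IntervalIntegrable h volume 0 1 := hdi.sub (hTi 0 1)
  have hH : ∀ a ∈ Set.Icc (0 : ℝ) 1, ∀ b ∈ Set.Icc (0 : ℝ) 1,
      (f (b : UnitAddCircle) - G b) - (f (a : UnitAddCircle) - G a) = ∫ t in a..b, h t := by
    intro a ha b hb
    have hsub : Set.uIcc a b ⊆ Set.uIcc 0 1 := by
      rw [Set.uIcc_of_le (zero_le_one (α := ℝ))]; exact Set.uIcc_subset_Icc ha hb
    rw [hh, intervalIntegral.integral_sub (hdi.mono_set hsub) (hTi a b),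
      (hac.mono hsub).integral_deriv_eq_sub,
      intervalIntegral.integral_eq_sub_of_hasDerivAt (fun t _ => hG' t) (hTi a b)]
    ring
  set I := ∫ t in (0 : ℝ)..1, |h t| with hI
  have hI0 : 0 ≤ I := intervalIntegral.integral_nonneg zero_le_one fun t _ => abs_nonneg _
  have h01 : (((1 : ℝ) : ℝ) : UnitAddCircle) = ((0 : ℝ) : UnitAddCircle) := by
    rw [AddCircle.coe_period]; rfl
  have hTr : IntervalIntegrable (fun t : ℝ => (T (t : UnitAddCircle)).re) volume 0 1 := by
    have := (hTi 0 1).add (intervalIntegrable_const (c := k.re))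
    simpa using this
  have hk : |k.re| ≤ ε / 5 := by
    have e0 := hH 0 (by simp) 1 (by simp)
    rw [h01, sub_self] at e0
    have e1 : ∫ t in (0 : ℝ)..1, (deriv F t - (T (t : UnitAddCircle)).re) = - k.re := by
      have : ∫ t in (0 : ℝ)..1, h t =
          ∫ t in (0 : ℝ)..1, ((deriv F t - (T (t : UnitAddCircle)).re) + k.re) := by
        congr 1; ext t; simp only [hh]; ring
      rw [this, intervalIntegral.integral_add (hdi.sub hTr) intervalIntegrable_const] at e0
      simp at e0
      linarith
    rw [← abs_neg, ← e1]
    exact (intervalIntegral.abs_integral_le_integral_abs zero_le_one).trans hTε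
  have hIε : I ≤ 2 * (ε / 5) := by
    have : I ≤ ∫ t in (0 : ℝ)..1, (|deriv F t - (T (t : UnitAddCircle)).re| + |k.re|) := by
      refine intervalIntegral.integral_mono_on zero_le_one hhi.abs
        ((hdi.sub hTr).abs.add intervalIntegrable_const) fun t _ => ?_
      have := abs_add_le (deriv F t - (T (t : UnitAddCircle)).re) k.re
      simp only [hh]
      convert! this using 2
      ring
    rw [intervalIntegral.integral_add (hdi.sub hTr).abs intervalIntegrable_const] at this
    simp at this
    linarith
  have hvar := var_le (fun t : ℝ => f (t : UnitAddCircle) - G t) h hhi hH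
  have hosc : ∀ x y : UnitAddCircle, |(f x - G x) - (f y - G y)| ≤ I := by
    have hrep : ∀ x : UnitAddCircle, ∃ t ∈ Set.Icc (0 : ℝ) 1, (t : UnitAddCircle) = x := by
      intro x
      obtain ⟨t, ht, rfl⟩ := AddCircle.eq_coe_Ico x
      exact ⟨t, ⟨ht.1, ht.2.le⟩, rfl⟩
    intro x y
    obtain ⟨s, hs, rfl⟩ := hrep x
    obtain ⟨t, ht, rfl⟩ := hrep y
    wlog hst : t ≤ s generalizing s t
    · rw [abs_sub_comm]; exact this t ht s hs (le_of_not_ge hst)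
    rw [hH t ht s hs]
    exact (intervalIntegral.abs_integral_le_integral_abs hst).trans
      (intervalIntegral.integral_mono_interval ht.1 hst hs.2
        (Eventually.of_forall fun t => abs_nonneg _) hhi.abs)
  have hfi : Integrable f (volume : Measure UnitAddCircle) := int_cont ⟨f, hfc⟩
  have hsup : ∀ x : UnitAddCircle, |f x - G x| ≤ I := by
    intro x
    have e1 : ∫ y : UnitAddCircle, ((f x - G x) - (f y - G y)) = f x - G x := by
      have i2 : Integrable (fun y => f y - G y) (volume : Measure UnitAddCircle) := hfi.sub iG
      rw [integral_sub (integrable_const _) i2, integral_sub hfi iG, hf0, hG0]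
      simp [vol_one]
    rw [← e1]
    have := norm_integral_le_of_norm_le_const (μ := (volume : Measure UnitAddCircle))
      (f := fun y => (f x - G x) - (f y - G y)) (C := I) (Eventually.of_forall (hosc x))
    simpa [vol_one] using this
  unfold bvNorm
  have b1 : (⨆ x : UnitAddCircle, |f x - G x|) ≤ I := ciSup_le hsup
  have b2 : (eVariationOn (fun t : ℝ => f (t : UnitAddCircle) - G t) (Set.Icc 0 1)).toReal ≤ I :=
    ENNReal.toReal_le_of_le_ofReal hI0 hvar
  have : (⨆ x : UnitAddCircle, |f x - G x|) +
    (eVariationOn (fun t : ℝ => f (t : UnitAddCircle) - G t) (Set.Icc 0 1)).toReal < ε := by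
    linarith
  exact this

end approx

lemma cob_pOf {α : ℝ} (hα : Irrational α) (g : C(UnitAddCircle, ℝ)) (φ : C(UnitAddCircle, ℝ))
    {ε : ℝ} (hε : 0 < ε) : ∃ (n : ℕ) (k : ℝ), ∀ x,
      |(opP (pOf (fun z => g z - g (z - (α : UnitAddCircle)))) α ^ n) φ x - k| ≤ ε := by
  have h := cob_mixing hα ⟨fun z => Real.exp (g z), by fun_prop⟩ (fun x => Real.exp_pos _) φ hε
  have e : pOf (fun z => g z - g (z - (α : UnitAddCircle))) =
      fun x => Real.exp (g x) / (Real.exp (g x) + Real.exp (g (x - (α : UnitAddCircle)))) := by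
    ext x
    simp only [pOf, Real.exp_sub]
    have := Real.exp_pos (g x)
    have := Real.exp_pos (g (x - (α : UnitAddCircle)))
    field_simp
    try ring
  rw [e]
  exact h

/-- Theorem 1: for every irrational `α` there is a dense `G_δ` subset
`R(α)` of `𝒫` (in the norm `‖·‖_∞ + var`) such that for every `𝔣 ∈ R(α)` the random
walk on the circle with kernel `p(x,·) = 𝔭(x)δ_{x+α} + 𝔮(x)δ_{x-α}`,
`𝔭 = e^𝔣/(1+e^𝔣)`, is mixing. -/
theorem statement0 (α : ℝ) (hα : Irrational α) :
    ∃ R : Set (UnitAddCircle → ℝ), R ⊆ {𝔣 | memP 𝔣} ∧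
      (∃ U : ℕ → Set (UnitAddCircle → ℝ),
        (∀ n, ∀ f ∈ U n, memP f →
          ∃ ε > 0, ∀ g, memP g → bvNorm (fun z => f z - g z) < ε → g ∈ U n) ∧
        (∀ n, ∀ f, memP f → ∀ ε > 0,
          ∃ g ∈ U n, memP g ∧ bvNorm (fun z => f z - g z) < ε) ∧
        R = {𝔣 | memP 𝔣} ∩ ⋂ n, U n) ∧
      ∀ 𝔣 ∈ R, Mixing (pOf 𝔣) α := by
  let ph : ℕ → C(UnitAddCircle, ℝ) := TopologicalSpace.denseSeq _
  let U : ℕ → Set (UnitAddCircle → ℝ) := fun n => {f | ∃ (N : ℕ) (k r : ℝ),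
    r < 1 / ((n.unpair.2 : ℝ) + 1) ∧ ∀ x, |(opP (pOf f) α ^ N) (ph n.unpair.1) x - k| ≤ r}
  have hp0 : ∀ f x, 0 ≤ pOf f x := fun f x => (pOf_pos f x).le
  have hp1 : ∀ f x, pOf f x ≤ 1 := fun f x => (pOf_lt f x).le
  refine ⟨{𝔣 | memP 𝔣} ∩ ⋂ n, U n, Set.inter_subset_left, ⟨U, ?_, ?_, rfl⟩, ?_⟩
  · rintro n f ⟨N, k, r, hr, hN⟩ hf
    set φ := ph n.unpair.1
    set R := 1 / ((n.unpair.2 : ℝ) + 1)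
    have hD : 0 < (N : ℝ) * (2 * ‖φ‖) + 1 := by positivity
    refine ⟨(R - r) / 2 / ((N : ℝ) * (2 * ‖φ‖) + 1), div_pos (by linarith) hD, fun g hg hfg => ?_⟩
    have hcl : ∀ x, |pOf g x - pOf f x| ≤ (R - r) / 2 / ((N : ℝ) * (2 * ‖φ‖) + 1) := fun x => by
      rw [abs_sub_comm]
      exact ((pOf_close f g x).trans (abs_le_bvNorm (hf.1.sub hg.1) x)).trans hfg.le
    refine ⟨N, k, (R + r) / 2, by linarith, fun x => ?_⟩
    have h1 := opP_close (a := (α : UnitAddCircle)) (hp0 g) (hp1 g) (hp0 f) (hp1 f) hcl φ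
      (C := ‖φ‖) (fun x => φ.norm_coe_le_norm x) N x
    have h2 : (N : ℝ) * (2 * ‖φ‖ * ((R - r) / 2 / ((N : ℝ) * (2 * ‖φ‖) + 1))) ≤ (R - r) / 2 := by
      rw [← mul_assoc, mul_div_assoc', div_le_iff₀ hD]
      nlinarith
    have h3 := abs_le.1 (h1.trans h2)
    have h4 := abs_le.1 (hN x)
    rw [abs_le]; constructor <;> linarith
  · intro n f hf ε hε
    obtain ⟨g, hg, hfg⟩ := approxP hα f hf hε
    refine ⟨_, ?_, hg, hfg⟩
    have hR : 0 < 1 / ((n.unpair.2 : ℝ) + 1) := by positivity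
    obtain ⟨N, k, h⟩ := cob_pOf hα g (ph n.unpair.1) (half_pos hR)
    exact ⟨N, k, _, half_lt_self hR, h⟩
  · rintro f ⟨hf, hU⟩
    refine mixing_of fun φ ε hε => ?_
    obtain ⟨i, hi⟩ := (TopologicalSpace.denseRange_denseSeq C(UnitAddCircle, ℝ)).exists_dist_lt φ
      (half_pos hε)
    obtain ⟨j, hj⟩ := exists_nat_one_div_lt (half_pos hε)
    obtain ⟨N, k, r, hr, h⟩ := Set.mem_iInter.1 hU (Nat.pair i j)
    rw [Nat.unpair_pair] at hr h
    simp only at hr h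
    refine ⟨N, k, fun x => ?_⟩
    have h1 := T_abs_pow (opP (pOf f) α) (opP_pos (hp0 f) (hp1 f)) opP_one N
      ((φ : UnitAddCircle → ℝ) - ph i) 0 (ε / 2) (fun y => by
        have := (ContinuousMap.dist_apply_le_dist (f := φ) (g := ph i) y).trans hi.le
        simpa [Real.dist_eq] using this) x
    rw [map_sub] at h1
    simp only [Pi.sub_apply, sub_zero] at h1
    have h1 := abs_le.1 h1
    have h2 := abs_le.1 (h x)
    rw [abs_le]; constructor <;> linarith
end
end

section
/- If 𝔣 is continuous of bounded variation with ∫_𝕋 𝔣(x) dx = 0, then for every ε > 0 and every integer q ≥ 2 there exists n₀ such that |ℙ_x(ξ_n = a)/ℙ_x(ξ_n = b) − μ_{x,a}/μ_{x,b}| < ε for every n ≥ n₀, every x ∈ 𝕋, and all integers a, b ∈ [−q, q] both having the same parity as n. -/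
open MeasureTheory Filter Finset

noncomputable section

attribute [local instance] Classical.propDecidable

/-- The event that `ξ_n = a` and `ξ_i ≠ 0` for all `1 ≤ i < n`, i.e. a visit to `a` at
time `n` before the first return to `0`. -/
def firstRetSet {Ω : Type} (ξ : ℕ → Ω → ℤ) (n : ℕ) (a : ℤ) : Set Ω :=
  {ω | (∀ i, 1 ≤ i → i < n → ξ i ω ≠ 0) ∧ ξ n ω = a}

/-- `μ_{x,a} = Σ_{n≥1} ℙ_x(ξ_1 ≠ 0, …, ξ_{n-1} ≠ 0, ξ_n = a)`, the expected number of
visits of `(ξ_n)` to `a` before the first return to `0`. -/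
def muW {Ω : Type} [MeasurableSpace Ω] (ℙ : Measure Ω) (ξ : ℕ → Ω → ℤ) (a : ℤ) : ℝ :=
  ∑' n : ℕ, (ℙ (firstRetSet ξ (n + 1) a)).toReal



namespace QP

/-- right jump probability -/
def ep (f : ℤ → ℝ) (j : ℤ) : ℝ := Real.exp (f j) / (1 + Real.exp (f j))

/-- two sided Birkhoff sums -/
def SS (f : ℤ → ℝ) (j : ℤ) : ℝ := ∑ i ∈ Ico 0 j, f i - ∑ i ∈ Ico j 0, f i

/-- reversible measure -/
def ww (f : ℤ → ℝ) (j : ℤ) : ℝ := Real.exp (SS f j) * (1 + Real.exp (f j))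

/-- generator -/
def LL (f : ℤ → ℝ) (u : ℤ → ℝ) (j : ℤ) : ℝ :=
  ep f j * u (j + 1) + (1 - ep f j) * u (j - 1)

/-- recurrence -/
def Rec (f : ℤ → ℝ) : Prop :=
  Tendsto (fun N : ℕ => ∑ n ∈ range N, Real.exp (-SS f ((n : ℤ) + 1))) atTop atTop ∧
  Tendsto (fun N : ℕ => ∑ n ∈ range N, Real.exp (-SS f (-(n : ℤ)))) atTop atTop

lemma SS_zero (f : ℤ → ℝ) : SS f 0 = 0 := by simp [SS]

lemma SS_succ (f : ℤ → ℝ) (j : ℤ) : SS f (j + 1) = SS f j + f j := by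
  unfold SS
  rcases le_or_gt 0 j with h | h
  · rw [Finset.Ico_eq_empty (a := j + 1) (by omega), Finset.Ico_eq_empty (a := j) (b := 0) (by omega),
      ← Finset.sum_Ico_add_eq_sum_Ico_add_one h f]
    simp
  · rw [Finset.Ico_eq_empty (a := 0) (by omega), Finset.Ico_eq_empty (a := 0) (b := j) (by omega)]
    have : Finset.Ico j 0 = insert j (Finset.Ico (j + 1) 0) := by
      ext i; simp only [Finset.mem_Ico, Finset.mem_insert]; omega
    rw [this, Finset.sum_insert (by simp)]
    ring

lemma ep_pos (f : ℤ → ℝ) (j : ℤ) : 0 < ep f j := by unfold ep; positivity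

lemma one_sub_ep (f : ℤ → ℝ) (j : ℤ) : 1 - ep f j = 1 / (1 + Real.exp (f j)) := by
  unfold ep
  have : 0 < Real.exp (f j) := Real.exp_pos _
  field_simp
  ring

lemma eq_pos (f : ℤ → ℝ) (j : ℤ) : 0 < 1 - ep f j := by
  rw [one_sub_ep]; positivity

lemma ww_pos (f : ℤ → ℝ) (j : ℤ) : 0 < ww f j := by unfold ww; positivity

lemma ww_ep (f : ℤ → ℝ) (j : ℤ) : ww f j * ep f j = Real.exp (SS f (j + 1)) := by
  rw [SS_succ, Real.exp_add]
  unfold ww ep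
  have : 0 < Real.exp (f j) := Real.exp_pos _
  field_simp

lemma ww_eq (f : ℤ → ℝ) (j : ℤ) : ww f j * (1 - ep f j) = Real.exp (SS f j) := by
  rw [one_sub_ep]
  unfold ww
  have : 0 < Real.exp (f j) := Real.exp_pos _
  field_simp

/-- harmonicity in conductance form -/
lemma harm_iff (f u : ℤ → ℝ) (j : ℤ) (h : LL f u j = u j) :
    (u (j + 1) - u j) * Real.exp (SS f (j + 1)) = (u j - u (j - 1)) * Real.exp (SS f j) := by
  rw [← ww_ep, ← ww_eq]
  unfold LL at h
  linear_combination (ww f j) * h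

lemma right_formula (f u : ℤ → ℝ) (h : ∀ j, 1 ≤ j → LL f u j = u j) (N : ℕ) :
    u N = u 0 + ((u 1 - u 0) * Real.exp (SS f 1)) *
      ∑ n ∈ range N, Real.exp (-SS f ((n : ℤ) + 1)) := by
  have key : ∀ n : ℕ, (u ((n : ℤ) + 1) - u n) * Real.exp (SS f ((n : ℤ) + 1)) =
      (u 1 - u 0) * Real.exp (SS f 1) := by
    intro n
    induction n with
    | zero => simp
    | succ n ih =>
      have := harm_iff f u ((n : ℤ) + 1) (h _ (by omega))
      push_cast
      rw [this, ← ih]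
      simp
  induction N with
  | zero => simp
  | succ N ih =>
    rw [Finset.sum_range_succ, mul_add, ← add_assoc, ← ih, ← key N, mul_assoc, ← Real.exp_add]
    push_cast
    simp

lemma left_formula (f u : ℤ → ℝ) (h : ∀ j, j ≤ -1 → LL f u j = u j) (N : ℕ) :
    u (-(N : ℤ)) = u 0 + ((u (-1) - u 0) * Real.exp (SS f 0)) *
      ∑ n ∈ range N, Real.exp (-SS f (-(n : ℤ))) := by
  have key : ∀ n : ℕ, (u (-(n : ℤ) - 1) - u (-(n : ℤ))) * Real.exp (SS f (-(n : ℤ))) =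
      (u (-1) - u 0) * Real.exp (SS f 0) := by
    intro n
    induction n with
    | zero => simp
    | succ n ih =>
      have := harm_iff f u (-(n : ℤ) - 1) (h _ (by omega))
      rw [← ih]
      have e : -(((n + 1 : ℕ)) : ℤ) = -(n : ℤ) - 1 := by push_cast; ring
      rw [e]
      rw [sub_add_cancel] at this
      linear_combination this
  induction N with
  | zero => simp
  | succ N ih =>
    rw [Finset.sum_range_succ, mul_add, ← add_assoc, ← ih, ← key N, mul_assoc, ← Real.exp_add]
    have e : -(((N + 1 : ℕ)) : ℤ) = -(N : ℤ) - 1 := by push_cast; ring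
    rw [e]
    simp

lemma nonneg_coef {s : ℕ → ℝ} (hs : Tendsto s atTop atTop) {a b : ℝ} (h : ∀ N, 0 ≤ a + b * s N) :
    0 ≤ b := by
  by_contra hb
  push Not at hb
  have : Tendsto (fun N => b * s N) atTop atBot := hs.const_mul_atTop_of_neg hb
  obtain ⟨N, hN⟩ := (this.eventually (eventually_lt_atBot (-a))).exists
  have := h N
  linarith

/-- Liouville type lemma. -/
lemma liouville (f u : ℤ → ℝ) (hR : Rec f) (h0 : ∀ j, 0 ≤ u j)
    (h : ∀ j, j ≠ 0 → LL f u j = u j) (hs : LL f u 0 ≤ u 0) (j : ℤ) : u j = u 0 := by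
  have r := right_formula f u (fun j hj => h j (by omega))
  have l := left_formula f u (fun j hj => h j (by omega))
  have c1 := nonneg_coef hR.1 (fun N => (r N) ▸ h0 N)
  have c2 := nonneg_coef hR.2 (fun N => (l N) ▸ h0 (-(N : ℤ)))
  have d1 : 0 ≤ u 1 - u 0 := nonneg_of_mul_nonneg_left c1 (Real.exp_pos _)
  have d2 : 0 ≤ u (-1) - u 0 := nonneg_of_mul_nonneg_left c2 (Real.exp_pos _)
  unfold LL at hs
  simp only [zero_add, zero_sub] at hs
  have p1 := ep_pos f 0
  have p2 := eq_pos f 0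
  have e1 : u 1 - u 0 = 0 := by
    refine le_antisymm ?_ d1
    by_contra hh
    push Not at hh
    nlinarith [mul_pos p1 hh, mul_nonneg p2.le d2]
  have e2 : u (-1) - u 0 = 0 := by
    refine le_antisymm ?_ d2
    by_contra hh
    push Not at hh
    nlinarith [mul_pos p2 hh, mul_nonneg p1.le d1]
  rcases Int.eq_nat_or_neg j with ⟨n, rfl | rfl⟩
  · rw [r n, e1]; simp
  · rw [l n, e2]; simp

lemma exists_freq_tendsto {s : ℕ → ℝ} (C : ℝ) (h : ∀ M : ℕ, ∃ n ≥ M, s n ≤ C) :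
    Tendsto (fun N : ℕ => ∑ n ∈ range N, Real.exp (-s n)) atTop atTop := by
  have h1 : ¬ Summable (fun n => Real.exp (-s n)) := by
    intro hS
    have := hS.tendsto_atTop_zero
    have := (this.eventually (gt_mem_nhds (Real.exp_pos (-C))))
    obtain ⟨M, hM⟩ := eventually_atTop.1 this
    obtain ⟨n, hn, hn2⟩ := h M
    have := hM n hn
    rw [Real.exp_lt_exp] at this
    linarith
  exact (not_summable_iff_tendsto_nat_atTop_of_nonneg (fun n => (Real.exp_pos _).le)).1 h1

lemma rec_of_bdd (f : ℤ → ℝ) (C : ℝ) (h : ∀ M : ℕ, ∃ n > M, SS f n ≤ C ∧ SS f (-(n : ℤ)) ≤ C) :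
    Rec f := by
  constructor
  · refine exists_freq_tendsto C (fun M => ?_)
    obtain ⟨n, hn, h1, -⟩ := h M
    refine ⟨n - 1, by omega, ?_⟩
    have : ((n - 1 : ℕ) : ℤ) + 1 = n := by omega
    rw [this]; exact h1
  · refine exists_freq_tendsto C (fun M => ?_)
    obtain ⟨n, hn, -, h1⟩ := h M
    exact ⟨n, hn.le, h1⟩

end QP



namespace QP

/-- weighted inner product -/
def inn (f u v : ℤ → ℝ) : ℝ := ∑' j, ww f j * u j * v j

/-- delta function -/
def dl (k : ℤ) (j : ℤ) : ℝ := if j = k then 1 else 0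

/-- finite support -/
def FS (u : ℤ → ℝ) : Prop := u.support.Finite

lemma FS.summ {u : ℤ → ℝ} (hu : FS u) (g : ℤ → ℝ) : Summable (fun j => g j * u j) := by
  apply summable_of_hasFiniteSupport
  exact hu.subset (fun j hj => by
    simp only [Function.mem_support] at hj ⊢
    intro h; apply hj; simp [h])

lemma FS.shift {u : ℤ → ℝ} (hu : FS u) (k : ℤ) : FS (fun j => u (j + k)) := by
  unfold FS
  have : (fun j => u (j + k)).support = (fun j => j + k) ⁻¹' u.support := by
    ext; simp
  rw [this]
  exact hu.preimage (fun a _ b _ h => by simpa using h)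

lemma FS.mulLeft {u : ℤ → ℝ} (hu : FS u) (g : ℤ → ℝ) : FS (fun j => g j * u j) :=
  hu.subset (fun j hj => by
    simp only [Function.mem_support] at hj ⊢
    intro h; apply hj; simp [h])

lemma FS.add {u v : ℤ → ℝ} (hu : FS u) (hv : FS v) : FS (fun j => u j + v j) :=
  (hu.union hv).subset (fun j hj => by
    simp only [Function.mem_support, Set.mem_union] at hj ⊢
    by_contra h; push Not at h; apply hj; simp [h])

lemma FS.LL {u : ℤ → ℝ} (hu : FS u) (f : ℤ → ℝ) : FS (LL f u) :=
  ((hu.shift 1).mulLeft _).add ((hu.shift (-1)).mulLeft _)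

lemma FS_dl (k : ℤ) : FS (dl k) :=
  (Set.finite_singleton k).subset (fun j hj => by
    simp only [Function.mem_support, dl] at hj
    by_contra h; apply hj; simp at h; simp [h])

lemma FS.iter {u : ℤ → ℝ} (hu : FS u) (f : ℤ → ℝ) (n : ℕ) : FS ((QP.LL f)^[n] u) := by
  induction n with
  | zero => exact hu
  | succ n ih => rw [Function.iterate_succ_apply']; exact ih.LL f

lemma inn_comm (f u v : ℤ → ℝ) : inn f u v = inn f v u := by
  unfold inn; congr 1; ext j; ring

lemma inn_summ (f : ℤ → ℝ) {u : ℤ → ℝ} (hu : FS u) (v : ℤ → ℝ) :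
    Summable (fun j => ww f j * u j * v j) :=
  (hu.summ (fun j => ww f j * v j)).congr (fun j => by ring)

lemma inn_symm (f : ℤ → ℝ) {u : ℤ → ℝ} (hu : FS u) (v : ℤ → ℝ) :
    inn f (LL f u) v = inn f u (LL f v) := by
  unfold inn
  have s1 : Summable (fun j => Real.exp (SS f (j + 1)) * v j * u (j + 1)) :=
    (hu.shift 1).summ (fun j => Real.exp (SS f (j + 1)) * v j)
  have s2 : Summable (fun j => Real.exp (SS f j) * v j * u (j - 1)) :=
    (hu.shift (-1)).summ (fun j => Real.exp (SS f j) * v j)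
  have s3 : Summable (fun j => Real.exp (SS f j) * v (j - 1) * u j) :=
    hu.summ (fun j => Real.exp (SS f j) * v (j - 1))
  have s4 : Summable (fun j => Real.exp (SS f (j + 1)) * v (j + 1) * u j) :=
    hu.summ (fun j => Real.exp (SS f (j + 1)) * v (j + 1))
  have e1 : ∑' j, ww f j * LL f u j * v j =
      ∑' j, (Real.exp (SS f (j + 1)) * v j * u (j + 1) + Real.exp (SS f j) * v j * u (j - 1)) := by
    congr 1; ext j; rw [← ww_ep, ← ww_eq]; unfold LL; ring
  have e2 : ∑' j, ww f j * u j * LL f v j =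
      ∑' j, (Real.exp (SS f j) * v (j - 1) * u j + Real.exp (SS f (j + 1)) * v (j + 1) * u j) := by
    congr 1; ext j; rw [← ww_ep, ← ww_eq]; unfold LL; ring
  rw [e1, e2, s1.tsum_add s2, s3.tsum_add s4]
  congr 1
  · rw [← Equiv.tsum_eq (Equiv.addRight (1 : ℤ)) (fun j => Real.exp (SS f j) * v (j - 1) * u j)]
    simp
  · rw [← Equiv.tsum_eq (Equiv.addRight (1 : ℤ)) (fun j => Real.exp (SS f j) * v j * u (j - 1))]
    simp

lemma inn_symm_iter (f : ℤ → ℝ) {u : ℤ → ℝ} (hu : FS u) (v : ℤ → ℝ) (n : ℕ) :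
    inn f ((LL f)^[n] u) v = inn f u ((LL f)^[n] v) := by
  induction n generalizing v with
  | zero => rfl
  | succ n ih =>
    rw [Function.iterate_succ_apply', inn_symm f (hu.iter f n), ih, Function.iterate_succ_apply]

lemma inn_self_nonneg (f u : ℤ → ℝ) : 0 ≤ inn f u u :=
  tsum_nonneg (fun j => by
    have := ww_pos f j
    rw [mul_assoc]; exact mul_nonneg this.le (mul_self_nonneg _))

lemma inn_dl (f : ℤ → ℝ) (u : ℤ → ℝ) (k : ℤ) : inn f u (dl k) = ww f k * u k := by
  unfold inn
  rw [tsum_eq_single k]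
  · simp [dl]
  · intro j hj; simp [dl, hj]

lemma inn_cs (f : ℤ → ℝ) {u v : ℤ → ℝ} (hu : FS u) (hv : FS v) :
    inn f u v ^ 2 ≤ inn f u u * inn f v v := by
  have key : ∀ t : ℝ, 0 ≤ inn f u u * (t * t) + (2 * inn f u v) * t + inn f v v := by
    intro t
    have := inn_self_nonneg f (fun j => t * u j + v j)
    refine this.trans_eq ?_
    unfold inn
    have a1 := (inn_summ f hu u).mul_right (t * t)
    have a2 := ((inn_summ f hu v).mul_left 2).mul_right t
    have a3 := inn_summ f hv v
    rw [← tsum_mul_right, ← tsum_mul_left, ← tsum_mul_right, ← a1.tsum_add a2,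
      ← (a1.add a2).tsum_add a3]
    congr 1; ext j; ring
  have := discrim_le_zero key
  unfold discrim at this
  nlinarith

lemma LL_one (f : ℤ → ℝ) : LL f (fun _ => 1) = fun _ => 1 := by
  ext j; unfold LL; ring

lemma LL_mono (f : ℤ → ℝ) {u v : ℤ → ℝ} (h : ∀ j, u j ≤ v j) (j : ℤ) : LL f u j ≤ LL f v j := by
  unfold LL
  exact add_le_add (mul_le_mul_of_nonneg_left (h _) (ep_pos f j).le)
    (mul_le_mul_of_nonneg_left (h _) (eq_pos f j).le)

lemma LL_iter_mono (f : ℤ → ℝ) {u v : ℤ → ℝ} (h : ∀ j, u j ≤ v j) (n : ℕ) (j : ℤ) :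
    (LL f)^[n] u j ≤ (LL f)^[n] v j := by
  induction n generalizing j with
  | zero => exact h j
  | succ n ih => rw [Function.iterate_succ_apply', Function.iterate_succ_apply']; exact LL_mono f ih j

lemma LL_smul (f : ℤ → ℝ) (c : ℝ) (u : ℤ → ℝ) : LL f (fun j => c * u j) = fun j => c * LL f u j := by
  ext j; unfold LL; ring

lemma LL_iter_smul (f : ℤ → ℝ) (c : ℝ) (u : ℤ → ℝ) (n : ℕ) :
    (LL f)^[n] (fun j => c * u j) = fun j => c * (LL f)^[n] u j := by
  induction n with
  | zero => rfl
  | succ n ih => rw [Function.iterate_succ_apply', ih, LL_smul, Function.iterate_succ_apply']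

lemma inn_contr (f : ℤ → ℝ) {u : ℤ → ℝ} (hu : FS u) : inn f (LL f u) (LL f u) ≤ inn f u u := by
  have hu2 : FS (fun j => u j * u j) := hu.mulLeft _
  have e : inn f u u = inn f (LL f (fun j => u j * u j)) (fun _ => 1) := by
    rw [inn_symm f hu2, LL_one]
    unfold inn; congr 1; ext j; ring
  rw [e]
  unfold inn
  refine (inn_summ f (hu.LL f) _).tsum_le_tsum (fun j => ?_) (inn_summ f (hu2.LL f) _)
  rw [mul_assoc, mul_assoc]
  refine mul_le_mul_of_nonneg_left ?_ (ww_pos f j).le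
  unfold LL
  have p1 := ep_pos f j
  have p2 := eq_pos f j
  nlinarith [mul_nonneg (mul_pos p1 p2).le (sq_nonneg (u (j + 1) - u (j - 1)))]

/-- probability to be at zero at time n, as function of starting point -/
def hh (f : ℤ → ℝ) (n : ℕ) : ℤ → ℝ := (LL f)^[n] (dl 0)

/-- even return probabilities -/
def AA (f : ℤ → ℝ) (n : ℕ) : ℝ := hh f (2 * n) 0

lemma hh_succ (f : ℤ → ℝ) (n : ℕ) (j : ℤ) : hh f (n + 1) j = LL f (hh f n) j := by
  unfold hh; rw [Function.iterate_succ_apply']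

lemma hh_FS (f : ℤ → ℝ) (n : ℕ) : FS (hh f n) := (FS_dl 0).iter f n

lemma hh_nonneg (f : ℤ → ℝ) (n : ℕ) (j : ℤ) : 0 ≤ hh f n j := by
  induction n generalizing j with
  | zero => simp only [hh, Function.iterate_zero, id, dl]; split_ifs <;> norm_num
  | succ n ih =>
    rw [hh_succ]; unfold LL
    exact add_nonneg (mul_nonneg (ep_pos f j).le (ih _)) (mul_nonneg (eq_pos f j).le (ih _))

lemma inn_hh (f : ℤ → ℝ) (m n : ℕ) : inn f (hh f m) (hh f n) = ww f 0 * hh f (m + n) 0 := by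
  unfold hh
  rw [inn_comm, inn_symm_iter f (FS_dl 0), inn_comm, inn_dl, ← Function.iterate_add_apply, add_comm]

lemma inn_AA (f : ℤ → ℝ) (n : ℕ) : inn f (hh f n) (hh f n) = ww f 0 * AA f n := by
  rw [inn_hh, AA, two_mul]

lemma AA_nonneg (f : ℤ → ℝ) (n : ℕ) : 0 ≤ AA f n := hh_nonneg f _ _

lemma AA_pos (f : ℤ → ℝ) (n : ℕ) : 0 < AA f n := by
  induction n with
  | zero => simp [AA, hh, dl]
  | succ n ih =>
    unfold AA at *
    rw [show 2 * (n + 1) = 2 * n + 1 + 1 by ring, hh_succ]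
    unfold LL
    rw [hh_succ, hh_succ]
    have h1 : 0 ≤ LL f (hh f (2 * n)) (0 - 1) := by rw [← hh_succ]; exact hh_nonneg _ _ _
    have h2 : 0 < LL f (hh f (2 * n)) (0 + 1) := by
      unfold LL
      have := mul_pos (eq_pos f (0 + 1)) ih
      have h3 := mul_nonneg (ep_pos f (0 + 1)).le (hh_nonneg f (2 * n) (0 + 1 + 1))
      simp only [zero_add, sub_self] at *
      linarith
    exact add_pos_of_pos_of_nonneg (mul_pos (ep_pos f 0) h2) (mul_nonneg (eq_pos f 0).le h1)

lemma AA_succ_le (f : ℤ → ℝ) (n : ℕ) : AA f (n + 1) ≤ AA f n := by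
  have := inn_contr f (hh_FS f n)
  have e : LL f (hh f n) = hh f (n + 1) := by ext j; rw [hh_succ]
  rw [e, inn_AA, inn_AA] at this
  exact le_of_mul_le_mul_left this (ww_pos f 0)

lemma AA_anti (f : ℤ → ℝ) : Antitone (AA f) := antitone_nat_of_succ_le (AA_succ_le f)

lemma AA_logconvex (f : ℤ → ℝ) (n : ℕ) : AA f (n + 1) ^ 2 ≤ AA f n * AA f (n + 2) := by
  have := inn_cs f (hh_FS f n) (hh_FS f (n + 2))
  rw [inn_hh, inn_AA, inn_AA] at this
  have e : hh f (n + (n + 2)) 0 = AA f (n + 1) := by unfold AA; congr 1; ring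
  rw [e] at this
  have hw : 0 < ww f 0 ^ 2 := pow_pos (ww_pos f 0) 2
  refine le_of_mul_le_mul_left ?_ hw
  nlinarith

lemma ratio_mono (f : ℤ → ℝ) : Monotone (fun n => AA f (n + 1) / AA f n) := by
  refine monotone_nat_of_le_succ (fun n => ?_)
  rw [div_le_div_iff₀ (AA_pos f _) (AA_pos f _)]
  have := AA_logconvex f n
  nlinarith

lemma ratio_le_one (f : ℤ → ℝ) (n : ℕ) : AA f (n + 1) / AA f n ≤ 1 := by
  rw [div_le_one (AA_pos f _)]; exact AA_succ_le f n

/-- ellipticity -/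
def Ell (c : ℝ) (f : ℤ → ℝ) : Prop := 0 < c ∧ ∀ j, c ≤ ep f j ∧ c ≤ 1 - ep f j

lemma hh_step {c : ℝ} {f : ℤ → ℝ} (hE : Ell c f) (n : ℕ) (j : ℤ) :
    hh f n (j + 1) * c ≤ hh f (n + 1) j ∧ hh f n (j - 1) * c ≤ hh f (n + 1) j := by
  rw [hh_succ]; unfold LL
  have h1 := hh_nonneg f n (j + 1)
  have h2 := hh_nonneg f n (j - 1)
  have p1 := ep_pos f j
  have p2 := eq_pos f j
  have := hE.2 j
  constructor
  · nlinarith [mul_le_mul_of_nonneg_left this.1 h1, mul_nonneg p2.le h2]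
  · nlinarith [mul_le_mul_of_nonneg_left this.2 h2, mul_nonneg p1.le h1]

lemma hh_bound {c : ℝ} {f : ℤ → ℝ} (hE : Ell c f) (n : ℕ) (j : ℤ) :
    hh f n j * c ^ j.natAbs ≤ hh f (n + j.natAbs) 0 := by
  have hc := hE.1
  obtain ⟨m, hm | hm⟩ := Int.eq_nat_or_neg j
  · subst hm
    rw [Int.natAbs_natCast]
    induction m generalizing n with
    | zero => simp
    | succ m ih =>
      have := (hh_step hE n m).1
      calc hh f n ((m + 1 : ℕ) : ℤ) * c ^ (m + 1) = (hh f n ((m : ℤ) + 1) * c) * c ^ m := by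
            push_cast; ring
        _ ≤ hh f (n + 1) m * c ^ m := mul_le_mul_of_nonneg_right this (by positivity)
        _ ≤ hh f (n + 1 + m) 0 := ih _
        _ = _ := by congr 1; ring
  · subst hm
    rw [Int.natAbs_neg, Int.natAbs_natCast]
    induction m generalizing n with
    | zero => simp
    | succ m ih =>
      have := (hh_step hE n (-(m : ℤ))).2
      calc hh f n (-((m + 1 : ℕ) : ℤ)) * c ^ (m + 1) = (hh f n (-(m : ℤ) - 1) * c) * c ^ m := by
            have : -((m + 1 : ℕ) : ℤ) = -(m : ℤ) - 1 := by push_cast; ring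
            rw [this]; ring
        _ ≤ hh f (n + 1) (-(m : ℤ)) * c ^ m := mul_le_mul_of_nonneg_right this (by positivity)
        _ ≤ hh f (n + 1 + m) 0 := ih _
        _ = _ := by congr 1; ring

lemma hh_diag {c : ℝ} {f : ℤ → ℝ} (hE : Ell c f) (j : ℤ) : c ^ j.natAbs ≤ hh f j.natAbs j := by
  have hc := hE.1
  obtain ⟨m, hm | hm⟩ := Int.eq_nat_or_neg j
  · subst hm
    rw [Int.natAbs_natCast]
    induction m with
    | zero => simp [hh, dl]
    | succ m ih =>
      have := (hh_step hE m ((m : ℤ) + 1)).2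
      rw [add_sub_cancel_right] at this
      push_cast
      refine le_trans ?_ this
      rw [pow_succ]; exact mul_le_mul_of_nonneg_right ih hc.le
  · subst hm
    rw [Int.natAbs_neg, Int.natAbs_natCast]
    induction m with
    | zero => simp [hh, dl]
    | succ m ih =>
      have := (hh_step hE m (-(m : ℤ) - 1)).1
      rw [sub_add_cancel] at this
      have e : -((m + 1 : ℕ) : ℤ) = -(m : ℤ) - 1 := by push_cast; ring
      rw [e]
      refine le_trans ?_ this
      rw [pow_succ]; exact mul_le_mul_of_nonneg_right ih hc.le

/-- parity-adapted kernel -/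
def HH (f : ℤ → ℝ) (n : ℕ) (j : ℤ) : ℝ := if Even j then hh f (2 * n) j else hh f (2 * n + 1) j

lemma HH_nonneg (f : ℤ → ℝ) (n : ℕ) (j : ℤ) : 0 ≤ HH f n j := by
  unfold HH; split_ifs <;> exact hh_nonneg _ _ _

lemma HH_bound {c : ℝ} {f : ℤ → ℝ} (hE : Ell c f) (n : ℕ) (j : ℤ) :
    HH f n j * c ^ j.natAbs ≤ AA f n := by
  unfold HH
  split_ifs with h
  · refine (hh_bound hE _ j).trans ?_
    obtain ⟨k, hk⟩ := Int.natAbs_even.2 h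
    rw [hk, show 2 * n + (k + k) = 2 * (n + k) by ring]
    exact AA_anti f (by omega)
  · refine (hh_bound hE _ j).trans ?_
    obtain ⟨k, hk⟩ := Int.natAbs_odd.2 (Int.not_even_iff_odd.1 h)
    rw [hk, show 2 * n + 1 + (2 * k + 1) = 2 * (n + k + 1) by ring]
    exact AA_anti f (by omega)

lemma HH_zero (f : ℤ → ℝ) (n : ℕ) : HH f n 0 = AA f n := by simp [HH, AA]

lemma LL_HH (f : ℤ → ℝ) (n : ℕ) (j : ℤ) :
    LL f (HH f n) j = if Even j then hh f (2 * n + 2) j else HH f n j := by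
  split_ifs with h
  · rw [hh_succ]
    have h1 : ¬ Even (j + 1) := by rw [Int.even_add_one]; simpa using h
    have h2 : ¬ Even (j - 1) := by rw [Int.even_sub_one]; simpa using h
    unfold LL HH
    rw [if_neg h1, if_neg h2]
  · unfold HH
    rw [if_neg h, hh_succ]
    have h1 : Even (j + 1) := by rw [Int.even_add_one]; simpa using h
    have h2 : Even (j - 1) := by rw [Int.even_sub_one]; simpa using h
    unfold LL
    simp only
    rw [if_pos h1, if_pos h2]

lemma AA_not_summable {c : ℝ} {f : ℤ → ℝ} (hE : Ell c f) (hR : Rec f) : ¬ Summable (AA f) := by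
  intro hS
  have hc := hE.1
  have hs : ∀ j, Summable (fun n => HH f n j) := by
    intro j
    refine Summable.of_nonneg_of_le (fun n => HH_nonneg f n j) (fun n => ?_)
      (hS.div_const (c ^ j.natAbs))
    rw [le_div_iff₀ (by positivity)]; exact HH_bound hE n j
  set G : ℤ → ℝ := fun j => ∑' n, HH f n j with hG
  have hLG : ∀ j, LL f G j = ∑' n, LL f (HH f n) j := by
    intro j
    unfold LL
    rw [((hs _).mul_left _).tsum_add ((hs _).mul_left _), tsum_mul_left, tsum_mul_left]
  have hev : ∀ j, Even j → LL f G j = G j - dl 0 j := by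
    intro j hj
    rw [hLG]
    have : G j = HH f 0 j + ∑' n, HH f (n + 1) j := (hs j).tsum_eq_zero_add
    rw [this]
    have e : HH f 0 j = dl 0 j := by simp [HH, hj, hh]
    rw [e, add_sub_cancel_left]
    congr 1; ext n
    rw [LL_HH, if_pos hj]
    unfold HH; rw [if_pos hj]; rfl
  have hoff : ∀ j, j ≠ 0 → LL f G j = G j := by
    intro j hj
    by_cases h : Even j
    · rw [hev j h]; simp [dl, hj]
    · rw [hLG]; congr 1; ext n; rw [LL_HH, if_neg h]
  have h0 : LL f G 0 = G 0 - 1 := by rw [hev 0 (by simp)]; simp [dl]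
  have := liouville f G hR (fun j => tsum_nonneg (fun n => HH_nonneg f n j)) hoff (by linarith)
  have : LL f G 0 = G 0 := by unfold LL; rw [this (0 + 1), this (0 - 1)]; ring
  linarith

lemma exists_ratio {c : ℝ} {f : ℤ → ℝ} (hE : Ell c f) (hR : Rec f) {ρ : ℝ} (h0 : 0 ≤ ρ) (hρ : ρ < 1) :
    ∃ m, ρ < AA f (m + 1) / AA f m := by
  by_contra hh
  push Not at hh
  apply AA_not_summable hE hR
  have hb : ∀ n, AA f n ≤ ρ ^ n * AA f 0 := by
    intro n
    induction n with
    | zero => simp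
    | succ n ih =>
      have := hh n
      rw [div_le_iff₀ (AA_pos f n)] at this
      calc _ ≤ ρ * AA f n := this
        _ ≤ ρ * (ρ ^ n * AA f 0) := mul_le_mul_of_nonneg_left ih h0
        _ = _ := by ring
  exact Summable.of_nonneg_of_le (AA_nonneg f) hb ((summable_geometric_of_lt_one h0 hρ).mul_right _)

lemma err_bound {c : ℝ} {f : ℤ → ℝ} (hE : Ell c f) (n : ℕ) (j : ℤ) :
    (ww f j * (hh f (2 * n + 2) j - hh f (2 * n) j)) ^ 2 ≤
      (ww f 0 * (AA f n - AA f (n + 1))) * ((1 / c ^ j.natAbs) ^ 2 * (ww f 0 * AA f n)) := by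
  have hc := hE.1
  set C := 1 / c ^ j.natAbs with hC
  have hC0 : 0 < C := by positivity
  set v := (LL f)^[n] (dl j) with hv
  have hvF : FS v := (FS_dl j).iter f n
  set g : ℤ → ℝ := fun i => hh f (n + 2) i + (-1) * hh f n i with hg
  have hgF : FS g := (hh_FS f _).add ((hh_FS f _).mulLeft (fun _ => -1))
  have lin : ∀ z : ℤ → ℝ, inn f g z = inn f (hh f (n + 2)) z - inn f (hh f n) z := by
    intro z
    unfold inn
    rw [← (inn_summ f (hh_FS f _) z).tsum_sub (inn_summ f (hh_FS f _) z)]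
    congr 1; ext i; simp only [hg]; ring
  have e1 : ∀ m, inn f (hh f m) v = ww f j * hh f (n + m) j := by
    intro m
    rw [hv, inn_comm, inn_symm_iter f (FS_dl j), inn_comm, inn_dl]
    unfold hh
    rw [← Function.iterate_add_apply]
  have e2 : inn f g v = ww f j * (hh f (2 * n + 2) j - hh f (2 * n) j) := by
    rw [lin, e1, e1, show n + (n + 2) = 2 * n + 2 by ring, show n + n = 2 * n by ring]; ring
  have e3 : inn f g g = ww f 0 * (AA f (n + 2) - 2 * AA f (n + 1) + AA f n) := by
    rw [lin, inn_comm f _ g, inn_comm f _ g, lin, lin]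
    rw [inn_hh, inn_hh, inn_hh, inn_hh]
    unfold AA
    rw [show n + 2 + (n + 2) = 2 * (n + 2) by ring, show n + (n + 2) = 2 * (n + 1) by ring,
      show n + 2 + n = 2 * (n + 1) by ring, show n + n = 2 * n by ring]
    ring
  have hvle : ∀ i, v i ≤ C * hh f (n + j.natAbs) i := by
    intro i
    have : ∀ k, dl j k ≤ C * hh f j.natAbs k := by
      intro k
      unfold dl
      split_ifs with h
      · subst h
        rw [hC, one_div, inv_mul_eq_div, le_div_iff₀ (by positivity), one_mul]
        exact hh_diag hE _
      · exact mul_nonneg hC0.le (hh_nonneg _ _ _)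
    have := LL_iter_mono f this n i
    rw [LL_iter_smul] at this
    unfold hh at this ⊢
    rwa [← Function.iterate_add_apply] at this
  have hv0 : ∀ i, 0 ≤ v i := by
    intro i
    have h0 : ∀ k, (0 : ℝ) * (0 : ℝ) ≤ dl j k := by
      intro k; unfold dl; split_ifs <;> norm_num
    have := LL_iter_mono f (u := fun _ => (0 : ℝ) * (0 : ℝ)) h0 n i
    rw [LL_iter_smul f 0 (fun _ => 0)] at this
    simpa using this
  have e4 : inn f v v ≤ C ^ 2 * (ww f 0 * AA f n) := by
    have : inn f v v ≤ C ^ 2 * inn f (hh f (n + j.natAbs)) (hh f (n + j.natAbs)) := by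
      unfold inn
      rw [← tsum_mul_left]
      refine (inn_summ f hvF v).tsum_le_tsum (fun i => ?_) ((inn_summ f (hh_FS f _) _).mul_left _)
      have hw := ww_pos f i
      have h1 := mul_le_mul (hvle i) (hvle i) (hv0 i) ((hv0 i).trans (hvle i))
      have := mul_le_mul_of_nonneg_left h1 hw.le
      calc _ = ww f i * (v i * v i) := by ring
        _ ≤ _ := this
        _ = _ := by ring
    refine this.trans ?_
    rw [inn_AA]
    have h1 : AA f (n + j.natAbs) ≤ AA f n := AA_anti f (by omega)
    have hw := ww_pos f 0
    gcongr
  have cs := inn_cs f hgF hvF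
  rw [e2, e3] at cs
  refine cs.trans ?_
  have h2 : AA f (n + 2) ≤ AA f (n + 1) := AA_succ_le f (n + 1)
  have hw := ww_pos f 0
  refine mul_le_mul (mul_le_mul_of_nonneg_left (by linarith) hw.le) e4 (inn_self_nonneg f v) ?_
  exact mul_nonneg hw.le (by linarith [AA_succ_le f n])

end QP



namespace QP

lemma cont_ep (j : ℤ) : Continuous (fun f : ℤ → ℝ => ep f j) := by
  unfold ep
  have : Continuous (fun f : ℤ → ℝ => Real.exp (f j)) := Real.continuous_exp.comp (continuous_apply j)
  exact this.div (continuous_const.add this) (fun f => by positivity)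

lemma cont_SS (j : ℤ) : Continuous (fun f : ℤ → ℝ => SS f j) := by
  unfold SS
  exact (continuous_finsetSum _ (fun i _ => continuous_apply i)).sub
    (continuous_finsetSum _ (fun i _ => continuous_apply i))

lemma cont_ww (j : ℤ) : Continuous (fun f : ℤ → ℝ => ww f j) := by
  unfold ww
  have : Continuous (fun f : ℤ → ℝ => Real.exp (f j)) := Real.continuous_exp.comp (continuous_apply j)
  exact (Real.continuous_exp.comp (cont_SS j)).mul (continuous_const.add this)

lemma cont_hh (n : ℕ) (j : ℤ) : Continuous (fun f : ℤ → ℝ => hh f n j) := by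
  induction n generalizing j with
  | zero => simp only [hh, Function.iterate_zero, id]; exact continuous_const
  | succ n ih =>
    simp only [hh_succ, LL]
    exact ((cont_ep j).mul (ih _)).add ((continuous_const.sub (cont_ep j)).mul (ih _))

lemma cont_ratio (n : ℕ) : Continuous (fun f : ℤ → ℝ => AA f (n + 1) / AA f n) :=
  (cont_hh _ _).div (cont_hh _ _) (fun f => (AA_pos f n).ne')

theorem main_conv {K : Set (ℤ → ℝ)} (hK : IsCompact K) {c : ℝ} (hE : ∀ f ∈ K, Ell c f)
    (hR : ∀ f ∈ K, Rec f) (j : ℤ) :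
    Tendsto (fun z : ℕ × (ℤ → ℝ) => HH z.2 z.1 j / AA z.2 z.1) (atTop ×ˢ 𝓟 K) (nhds 1) := by
  rw [tendsto_iff_ultrafilter]
  intro g hg
  have hfst : Tendsto Prod.fst (g : Filter (ℕ × (ℤ → ℝ))) atTop := tendsto_fst.mono_left hg
  have hsnd : Tendsto Prod.snd (g : Filter (ℕ × (ℤ → ℝ))) (𝓟 K) := tendsto_snd.mono_left hg
  have hKg : ∀ᶠ z in (g : Filter (ℕ × (ℤ → ℝ))), z.2 ∈ K := tendsto_principal.1 hsnd
  obtain ⟨f, hfK, hf⟩ := hK.ultrafilter_le_nhds (g.map Prod.snd) hsnd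
  have hf' : Tendsto Prod.snd (g : Filter (ℕ × (ℤ → ℝ))) (nhds f) := hf
  have hc : 0 < c := (hE f hfK).1
  -- ratio tends to one
  have hr : Tendsto (fun z : ℕ × (ℤ → ℝ) => AA z.2 (z.1 + 1) / AA z.2 z.1) g (nhds 1) := by
    rw [tendsto_order]
    constructor
    · intro a ha
      obtain ⟨m, hm⟩ := exists_ratio (hE f hfK) (hR f hfK) (le_max_right a 0)
        (max_lt ha one_pos)
      have h1 := (((cont_ratio m).tendsto f).comp hf').eventually (lt_mem_nhds hm)
      filter_upwards [h1, hfst.eventually (eventually_ge_atTop m)] with z hz1 hz2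
      exact (le_max_left a 0).trans_lt (hz1.trans_le (ratio_mono z.2 hz2))
    · intro a ha
      exact Eventually.of_forall (fun z => (ratio_le_one z.2 z.1).trans_lt ha)
  -- limit function
  have hlim : ∀ i, ∃ y, Tendsto (fun z : ℕ × (ℤ → ℝ) => HH z.2 z.1 i / AA z.2 z.1) g (nhds y) := by
    intro i
    have : ∀ᶠ z in (g : Filter (ℕ × (ℤ → ℝ))), HH z.2 z.1 i / AA z.2 z.1 ∈
        Set.Icc (0 : ℝ) (1 / c ^ i.natAbs) := by
      filter_upwards [hKg] with z hz
      refine ⟨div_nonneg (HH_nonneg _ _ _) (AA_nonneg _ _), ?_⟩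
      rw [div_le_div_iff₀ (AA_pos _ _) (by positivity), one_mul]
      exact HH_bound (hE _ hz) _ _
    obtain ⟨y, -, hy⟩ := isCompact_Icc.ultrafilter_le_nhds
      (g.map (fun z : ℕ × (ℤ → ℝ) => HH z.2 z.1 i / AA z.2 z.1)) (tendsto_principal.2 this)
    exact ⟨y, hy⟩
  choose u hu using hlim
  have hu0 : u 0 = 1 := by
    refine tendsto_nhds_unique (hu 0) ?_
    refine tendsto_const_nhds.congr (fun z => ?_)
    rw [HH_zero, div_self (AA_pos _ _).ne']
  have hun : ∀ i, 0 ≤ u i := fun i =>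
    ge_of_tendsto' (hu i) (fun z => div_nonneg (HH_nonneg _ _ _) (AA_nonneg _ _))
  have hep : ∀ i, Tendsto (fun z : ℕ × (ℤ → ℝ) => ep z.2 i) g (nhds (ep f i)) := fun i =>
    ((cont_ep i).tendsto f).comp hf'
  have hLLu : ∀ i, Tendsto (fun z : ℕ × (ℤ → ℝ) => LL z.2 (HH z.2 z.1) i / AA z.2 z.1) g
      (nhds (LL f u i)) := by
    intro i
    have := ((hep i).mul (hu (i + 1))).add (((tendsto_const_nhds (x := (1 : ℝ))).sub (hep i)).mul (hu (i - 1)))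
    refine this.congr (fun z => ?_)
    unfold LL; ring
  have herr : ∀ i, Tendsto (fun z : ℕ × (ℤ → ℝ) =>
      (hh z.2 (2 * z.1 + 2) i - hh z.2 (2 * z.1) i) / AA z.2 z.1) g (nhds 0) := by
    intro i
    have hb : Tendsto (fun z : ℕ × (ℤ → ℝ) => (ww z.2 0 / ww z.2 i) ^ 2 * (1 / c ^ i.natAbs) ^ 2 *
        (1 - AA z.2 (z.1 + 1) / AA z.2 z.1)) g
        (nhds ((ww f 0 / ww f i) ^ 2 * (1 / c ^ i.natAbs) ^ 2 * (1 - 1))) := by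
      have w0 := ((cont_ww 0).tendsto f).comp hf'
      have wi := ((cont_ww i).tendsto f).comp hf'
      exact (((w0.div wi (ww_pos f i).ne').pow 2).mul_const _).mul (tendsto_const_nhds.sub hr)
    rw [sub_self, mul_zero] at hb
    have hsq : Tendsto (fun z : ℕ × (ℤ → ℝ) =>
      ((hh z.2 (2 * z.1 + 2) i - hh z.2 (2 * z.1) i) / AA z.2 z.1) ^ 2) g (nhds 0) := by
      refine tendsto_of_tendsto_of_tendsto_of_le_of_le' tendsto_const_nhds hb
        (Eventually.of_forall fun z => sq_nonneg _) ?_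
      filter_upwards [hKg] with z hz
      have := err_bound (hE _ hz) z.1 i
      have hA := AA_pos z.2 z.1
      have hw := ww_pos z.2 i
      have hw0 := ww_pos z.2 0
      have e : (ww z.2 0 / ww z.2 i) ^ 2 * (1 / c ^ i.natAbs) ^ 2 *
        (1 - AA z.2 (z.1 + 1) / AA z.2 z.1) =
        ((ww z.2 0 * (AA z.2 z.1 - AA z.2 (z.1 + 1))) * ((1 / c ^ i.natAbs) ^ 2 * (ww z.2 0 * AA z.2 z.1)))
          / (ww z.2 i * AA z.2 z.1) ^ 2 := by
        field_simp
      rw [e, le_div_iff₀ (by positivity)]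
      refine le_trans (le_of_eq ?_) this
      field_simp
    have := hsq.sqrt
    simp only [Real.sqrt_sq_eq_abs, Real.sqrt_zero] at this
    exact (tendsto_zero_iff_abs_tendsto_zero _).2 this
  have hharm : ∀ i, LL f u i = u i := by
    intro i
    refine tendsto_nhds_unique (hLLu i) ?_
    by_cases hi : Even i
    · have := (hu i).add (herr i)
      rw [add_zero] at this
      refine this.congr (fun z => ?_)
      rw [LL_HH, if_pos hi]
      unfold HH
      rw [if_pos hi]; ring
    · refine (hu i).congr (fun z => ?_)
      rw [LL_HH, if_neg hi]
  have := liouville f u (hR f hfK) hun (fun i _ => hharm i) (hharm 0).le j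
  rw [hu0] at this
  rw [← this]
  exact hu j

/-- first hitting probabilities of zero -/
def tau (f : ℤ → ℝ) : ℕ → ℤ → ℝ
  | 0 => LL f (dl 0)
  | n + 1 => LL f (fun j => if j = 0 then 0 else tau f n j)

lemma tau_nonneg (f : ℤ → ℝ) (n : ℕ) (j : ℤ) : 0 ≤ tau f n j := by
  induction n generalizing j with
  | zero =>
    unfold tau LL dl
    refine add_nonneg (mul_nonneg (ep_pos f j).le ?_) (mul_nonneg (eq_pos f j).le ?_)
    all_goals (split_ifs; exact zero_le_one; exact le_rfl)
  | succ n ih =>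
    unfold tau LL
    refine add_nonneg (mul_nonneg (ep_pos f j).le ?_) (mul_nonneg (eq_pos f j).le ?_)
    all_goals (dsimp only; split_ifs; exact le_rfl; exact ih _)

lemma tau_partial (f : ℤ → ℝ) (N : ℕ) (j : ℤ) :
    ∑ n ∈ range (N + 1), tau f n j =
      LL f (fun i => if i = 0 then 1 else ∑ n ∈ range N, tau f n i) j := by
  rw [Finset.sum_range_succ']
  simp only [tau, LL]
  rw [Finset.sum_add_distrib, ← Finset.mul_sum, ← Finset.mul_sum]
  unfold dl
  by_cases h1 : j + 1 = 0 <;> by_cases h2 : j - 1 = 0 <;> simp [h1, h2] <;> ring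

lemma tau_hasSum {f : ℤ → ℝ} (hR : Rec f) (j : ℤ) : HasSum (fun n => tau f n j) 1 := by
  have hb : ∀ N j, ∑ n ∈ range N, tau f n j ≤ 1 := by
    intro N
    induction N with
    | zero => intro j; simp
    | succ N ih =>
      intro j
      rw [tau_partial]
      have := LL_mono f (v := fun _ => (1 : ℝ)) (u := fun i => if i = 0 then 1 else ∑ n ∈ range N, tau f n i)
        (fun i => by split_ifs; exact le_rfl; exact ih i) j
      rwa [LL_one] at this
  have hs : ∀ i, Summable (fun n => tau f n i) := fun i =>
    summable_of_sum_range_le (fun n => tau_nonneg f n i) (fun N => hb N i)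
  set F : ℤ → ℝ := fun i => ∑' n, tau f n i with hF
  have hF1 : ∀ i, F i ≤ 1 := fun i => (hs i).tsum_le_of_sum_range_le (fun N => hb N i)
  have hF0 : ∀ i, 0 ≤ F i := fun i => tsum_nonneg (fun n => tau_nonneg f n i)
  set u : ℤ → ℝ := fun i => if i = 0 then 1 else F i with hu
  have hlim : ∀ i, F i = LL f u i := by
    intro i
    have h1 := ((hs i).hasSum.tendsto_sum_nat).comp (tendsto_add_atTop_nat 1)
    refine tendsto_nhds_unique h1 ?_
    have hv : ∀ k, Tendsto (fun N => if k = 0 then (1 : ℝ) else ∑ n ∈ range N, tau f n k) atTop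
        (nhds (u k)) := by
      intro k
      simp only [hu]
      split_ifs
      · exact tendsto_const_nhds
      · exact (hs k).hasSum.tendsto_sum_nat
    have := ((hv (i + 1)).const_mul (ep f i)).add ((hv (i - 1)).const_mul (1 - ep f i))
    refine this.congr (fun N => ?_)
    simp only [Function.comp]
    rw [tau_partial]; rfl
  have hu0 : u 0 = 1 := by simp [hu]
  have hall := liouville f u hR
    (fun i => by simp only [hu]; split_ifs; exact zero_le_one; exact hF0 i)
    (fun i hi => by rw [← hlim]; simp [hu, hi])
    (by rw [← hlim, hu0]; exact hF1 0)
  have : F j = 1 := by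
    rw [hlim]; unfold LL
    rw [hall (j + 1), hall (j - 1), hu0]; ring
  rw [← this]
  exact (hs j).hasSum

end QP



namespace QP

lemma exists_large_den {α : ℝ} (hα : Irrational α) (M : ℕ) :
    ∃ r : ℚ, M < r.den ∧ |α - r| < 1 / (r.den : ℝ) ^ 2 := by
  by_contra hcon
  push Not at hcon
  have hinf := Real.infinite_rat_abs_sub_lt_one_div_den_sq_of_irrational hα
  apply hinf
  obtain ⟨B, hB⟩ := exists_nat_gt ((|α| + 1) * M)
  have hfin : ((Set.Icc (-(B : ℤ)) B) ×ˢ (Set.Icc 0 M)).Finite :=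
    (Set.finite_Icc _ _).prod (Set.finite_Icc _ _)
  refine (hfin.preimage (f := fun r : ℚ => (r.num, r.den)) ?_).subset ?_
  · intro a _ b _ h
    simp only [Prod.mk.injEq] at h
    exact Rat.ext h.1 h.2
  · intro r hr
    replace hr : |α - r| < 1 / (r.den : ℝ) ^ 2 := hr
    have hd : r.den ≤ M := by
      by_contra h
      push Not at h
      exact absurd hr (not_lt.2 (hcon r h))
    have hpos : (1 : ℝ) ≤ r.den := by exact_mod_cast r.den_pos
    have h1 : |α - r| < 1 := hr.trans_le (by
      rw [div_le_one (by positivity)]; nlinarith)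
    have h2 : |(r : ℝ)| ≤ |α| + 1 := by
      have := abs_sub_abs_le_abs_sub (r : ℝ) α
      rw [abs_sub_comm] at this
      linarith
    have h3 : |(r.num : ℝ)| ≤ B := by
      have : (r.num : ℝ) = r * r.den := by exact_mod_cast (Rat.mul_den_eq_num r).symm
      rw [this, abs_mul]
      have : |(r.den : ℝ)| ≤ M := by rw [Nat.abs_cast]; exact_mod_cast hd
      exact (mul_le_mul h2 this (abs_nonneg _) (by positivity)).trans hB.le
    rw [abs_le] at h3
    simp only [Set.mem_preimage, Set.mem_prod, Set.mem_Icc]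
    refine ⟨⟨?_, ?_⟩, Nat.zero_le _, hd⟩
    · exact_mod_cast h3.1
    · exact_mod_cast h3.2

lemma bv_shift {F : ℝ → ℝ} (hF : BoundedVariationOn F (Set.Icc 0 1)) (hper : ∀ t, F (t + 1) = F t)
    (n : ℕ) : BoundedVariationOn F (Set.Icc (-1 : ℝ) ((n : ℝ) - 1)) := by
  have hz : ∀ m : ℕ, BoundedVariationOn F (Set.Icc ((m : ℝ) - 1) (m : ℝ)) := by
    intro m
    have h1 : ∀ t, F t = (F ∘ (fun t => t - ((m : ℝ) - 1))) t := by
      intro t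
      have hp : Function.Periodic F 1 := hper
      have := hp.sub_int_mul_eq (x := t) ((m : ℤ) - 1)
      simp only [Function.comp]
      push_cast at this
      rw [mul_one] at this
      rw [this]
    have h2 : eVariationOn F (Set.Icc ((m : ℝ) - 1) (m : ℝ)) ≤ eVariationOn F (Set.Icc 0 1) := by
      conv_lhs => rw [funext h1]
      refine eVariationOn.comp_le_of_monotoneOn F _ (fun a _ b _ h => by simpa using h) ?_
      intro t ht
      simp only [Set.mem_Icc] at ht ⊢
      constructor <;> linarith
    exact ne_top_of_le_ne_top hF h2
  induction n with
  | zero => exact BoundedVariationOn.of_subsingleton (by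
      intro a ha b hb
      simp only [Set.mem_Icc] at ha hb
      push_cast at ha hb
      linarith [ha.1, ha.2, hb.1, hb.2])
  | succ n ih =>
    have := eVariationOn.Icc_add_Icc F (s := Set.univ) (a := -1) (b := (n : ℝ) - 1) (c := n)
      (by have := Nat.cast_nonneg (α := ℝ) n; linarith) (by linarith) (Set.mem_univ _)
    simp only [Set.univ_inter] at this
    unfold BoundedVariationOn
    push_cast
    rw [add_sub_cancel_right, ← this]
    exact ENNReal.add_ne_top.2 ⟨ih, hz n⟩

/-- Monotone control function. -/
lemma exists_control {F : ℝ → ℝ} (hF : BoundedVariationOn F (Set.Icc 0 1))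
    (hper : ∀ t, F (t + 1) = F t) :
    ∃ W : ℝ → ℝ, MonotoneOn W (Set.Icc (-1) 3) ∧
      ∀ s ∈ Set.Icc (-1 : ℝ) 3, ∀ t ∈ Set.Icc (-1 : ℝ) 3, s ≤ t → |F t - F s| ≤ W t - W s := by
  have h := bv_shift hF hper 4
  norm_num at h
  have hl := h.locallyBoundedVariationOn
  have hm : (-1 : ℝ) ∈ Set.Icc (-1 : ℝ) 3 := by norm_num
  refine ⟨variationOnFromTo F (Set.Icc (-1) 3) (-1), variationOnFromTo.monotoneOn hl hm, ?_⟩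
  intro s hs t ht hst
  exact variationOnFromTo.abs_sub_le_sub_of_le hl hm hs ht hst

lemma perm_sum (N : ℕ) (hN : 0 < N) (p : ℤ) (hp : IsCoprime p (N : ℤ)) (g : ℕ → ℝ) :
    ∑ i ∈ range N, g (((i : ℤ) * p) % N).toNat = ∑ k ∈ range N, g k := by
  have hN' : (0 : ℤ) < N := by exact_mod_cast hN
  have hinj : Set.InjOn (fun i : ℕ => (((i : ℤ) * p) % N).toNat) (range N : Set ℕ) := by
    intro a ha b hb hab
    simp only [Finset.coe_range, Set.mem_Iio] at ha hb
    have h1 := Int.emod_nonneg ((a : ℤ) * p) hN'.ne'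
    have h2 := Int.emod_nonneg ((b : ℤ) * p) hN'.ne'
    have h3 : ((a : ℤ) * p) % N = ((b : ℤ) * p) % N := by
      simp only at hab; omega
    have h4 : (N : ℤ) ∣ ((a : ℤ) - b) * p := by
      rw [sub_mul]; exact Int.ModEq.dvd (show (b : ℤ) * p ≡ a * p [ZMOD N] from h3.symm)
    have h5 : (N : ℤ) ∣ (a : ℤ) - b := hp.symm.dvd_of_dvd_mul_right h4
    have h6 : (a : ℤ) - b = 0 := Int.eq_zero_of_abs_lt_dvd h5 (by rw [abs_lt]; omega)
    omega
  have himg : (range N).image (fun i : ℕ => (((i : ℤ) * p) % N).toNat) = range N := by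
    apply Finset.eq_of_subset_of_card_le
    · intro k hk
      simp only [Finset.mem_image, Finset.mem_range] at hk ⊢
      obtain ⟨i, -, rfl⟩ := hk
      have h1 := Int.emod_nonneg ((i : ℤ) * p) hN'.ne'
      have h2 := Int.emod_lt_of_pos ((i : ℤ) * p) hN'
      omega
    · rw [Finset.card_image_of_injOn hinj]
  conv_rhs => rw [← himg]
  rw [Finset.sum_image hinj]

lemma denjoy_koksma {F : ℝ → ℝ} (hc : Continuous F) (hper : ∀ t, F (t + 1) = F t)
    (hint : ∀ t, ∫ s in t..t + 1, F s = 0) {W : ℝ → ℝ} (hW : MonotoneOn W (Set.Icc (-1) 3))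
    (hFW : ∀ s ∈ Set.Icc (-1 : ℝ) 3, ∀ t ∈ Set.Icc (-1 : ℝ) 3, s ≤ t → |F t - F s| ≤ W t - W s)
    {α : ℝ} {r : ℚ} (hr : |α - r| < 1 / (r.den : ℝ) ^ 2) (x : ℝ) (hx0 : 0 ≤ x) (hx1 : x ≤ 1) :
    |∑ i ∈ range r.den, F (x + i * α)| ≤ 2 * (W 3 - W (-1)) := by
  set N := r.den with hN
  have hNpos : 0 < N := r.den_pos
  have hN1 : (1 : ℝ) ≤ N := by exact_mod_cast hNpos
  have hN' : (0 : ℤ) < N := by exact_mod_cast hNpos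
  have hinvle : 1 / (N : ℝ) ≤ 1 := by rw [div_le_one (by positivity)]; exact hN1
  set κ : ℕ → ℕ := fun i => (((i : ℤ) * r.num) % N).toNat with hκ
  set I : ℕ → ℝ := fun k => ∫ s in (x + k / N)..(x + (k + 1 : ℕ) / N), F s with hI
  set D : ℕ → ℝ := fun k => W (x + (k + 1) / N) - W (x + (k - 1) / N) with hD
  have hmem : ∀ k < N, ∀ s, x + ((k : ℝ) - 1) / N ≤ s → s ≤ x + (k + 1) / N → s ∈ Set.Icc (-1 : ℝ) 3 := by
    intro k hk s h1 h2
    have hk' : (k : ℝ) + 1 ≤ N := by exact_mod_cast hk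
    have a1 : ((k : ℝ) + 1) / N ≤ 1 := by rw [div_le_one (by positivity)]; exact hk'
    have a2 : -1 ≤ ((k : ℝ) - 1) / N := by
      rw [le_div_iff₀ (by positivity)]
      have := Nat.cast_nonneg (α := ℝ) k
      linarith
    constructor <;> linarith
  have hosc : ∀ k < N, ∀ s t, x + ((k : ℝ) - 1) / N ≤ s → s ≤ x + (k + 1) / N →
      x + ((k : ℝ) - 1) / N ≤ t → t ≤ x + (k + 1) / N → |F s - F t| ≤ D k := by
    intro k hk s t hs1 hs2 ht1 ht2
    have hle : x + ((k : ℝ) - 1) / N ≤ x + (k + 1) / N := hs1.trans hs2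
    have ml := hmem k hk _ le_rfl hle
    have mr := hmem k hk _ hle le_rfl
    have ms := hmem k hk s hs1 hs2
    have mt := hmem k hk t ht1 ht2
    rcases le_total s t with h | h
    · rw [abs_sub_comm]
      have := hFW s ms t mt h
      have b1 := hW ml ms hs1
      have b2 := hW mt mr ht2
      simp only [hD]; linarith
    · have := hFW t mt s ms h
      have b1 := hW ml mt ht1
      have b2 := hW ms mr hs2
      simp only [hD]; linarith
  have hsumI : ∑ k ∈ range N, I k = 0 := by
    have := intervalIntegral.sum_integral_adjacent_intervals (f := F) (μ := volume)
      (a := fun k : ℕ => x + (k : ℝ) / N) (n := N) (fun k _ => hc.intervalIntegrable _ _)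
    simp only [hI]
    rw [this]
    have e : x + (N : ℝ) / N = x + 1 := by rw [div_self (by positivity)]
    rw [e]
    simpa using hint x
  -- pointwise comparison
  have hpt : ∀ i ∈ range N, |F (x + i * α) - N * I (κ i)| ≤ D (κ i) := by
    intro i hi
    rw [Finset.mem_range] at hi
    have h1 := Int.emod_nonneg ((i : ℤ) * r.num) hN'.ne'
    have h2 := Int.emod_lt_of_pos ((i : ℤ) * r.num) hN'
    have hk : κ i < N := by simp only [hκ]; omega
    have hkz : (κ i : ℤ) = ((i : ℤ) * r.num) % N := by simp only [hκ]; omega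
    obtain ⟨d, hd⟩ : ∃ d : ℤ, (i : ℤ) * r.num = κ i + N * d :=
      ⟨(i : ℤ) * r.num / N, by rw [hkz]; exact (Int.emod_add_mul_ediv _ _).symm⟩
    have hdR : (i : ℝ) * r.num = κ i + N * d := by exact_mod_cast hd
    have hrR : (r : ℝ) = r.num / N := by rw [hN]; exact_mod_cast (Rat.num_div_den r).symm
    set θ := (i : ℝ) * (α - r) with hθ
    have hθle : |θ| ≤ 1 / N := by
      rw [hθ, abs_mul, Nat.abs_cast]
      have hi' : (i : ℝ) ≤ N := by exact_mod_cast hi.le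
      calc (i : ℝ) * |α - r| ≤ N * (1 / (N : ℝ) ^ 2) :=
            mul_le_mul hi' hr.le (abs_nonneg _) (by positivity)
        _ = 1 / N := by field_simp
    have hval : F (x + i * α) = F (x + κ i / N + θ) := by
      have hp : Function.Periodic F 1 := hper
      have := hp.sub_int_mul_eq (x := x + i * α) d
      rw [← this]
      congr 1
      rw [hθ, hrR]
      have : (i : ℝ) * (r.num / N) = κ i / N + d := by
        rw [← mul_div_assoc, hdR]; field_simp
      linear_combination this
    rw [hval]
    set y := x + (κ i : ℝ) / N + θ with hy
    rw [abs_le] at hθle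
    have eN : N * I (κ i) = N * I (κ i) := rfl
    have hlen : x + ((κ i + 1 : ℕ) : ℝ) / N - (x + (κ i : ℝ) / N) = 1 / N := by
      push_cast; ring
    have hsub : F y - N * I (κ i) =
        N * ∫ s in (x + (κ i : ℝ) / N)..(x + ((κ i + 1 : ℕ) : ℝ) / N), (F y - F s) := by
      rw [intervalIntegral.integral_sub (by simp) (hc.intervalIntegrable _ _),
        intervalIntegral.integral_const, hlen, smul_eq_mul]
      simp only [hI]
      field_simp
    have hy1 : x + ((κ i : ℝ) - 1) / N ≤ y := by
      rw [hy, sub_div]; linarith [hθle.1]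
    have hy2 : y ≤ x + ((κ i : ℝ) + 1) / N := by
      rw [hy, add_div]; linarith [hθle.2]
    have hle : x + (κ i : ℝ) / N ≤ x + ((κ i + 1 : ℕ) : ℝ) / N := by
      have : 0 ≤ 1 / (N : ℝ) := by positivity
      linarith
    have hnorm : ‖∫ s in (x + (κ i : ℝ) / N)..(x + ((κ i + 1 : ℕ) : ℝ) / N), (F y - F s)‖ ≤
        D (κ i) * |x + ((κ i + 1 : ℕ) : ℝ) / N - (x + (κ i : ℝ) / N)| := by
      refine intervalIntegral.norm_integral_le_of_norm_le_const (fun s hs => ?_)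
      rw [Set.uIoc_of_le hle, Set.mem_Ioc] at hs
      have : 0 ≤ 1 / (N : ℝ) := by positivity
      refine hosc _ hk y s hy1 hy2 ?_ ?_
      · rw [sub_div]; linarith [hs.1]
      · have := hs.2; push_cast at this; exact this
    rw [hsub, abs_mul, Nat.abs_cast]
    rw [hlen, abs_of_nonneg (by positivity), Real.norm_eq_abs] at hnorm
    calc _ ≤ (N : ℝ) * (D (κ i) * (1 / N)) := mul_le_mul_of_nonneg_left hnorm (by positivity)
      _ = D (κ i) := by field_simp
  have hcop : IsCoprime r.num (N : ℤ) := Int.isCoprime_iff_gcd_eq_one.2 (by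
    have := r.reduced
    simpa [Int.gcd, Nat.Coprime] using this)
  have hpI : ∑ i ∈ range N, I (κ i) = 0 := by
    rw [← hsumI]; exact perm_sum N hNpos r.num hcop I
  have hpD : ∑ i ∈ range N, D (κ i) = ∑ k ∈ range N, D k := perm_sum N hNpos r.num hcop D
  have e1 : ∑ i ∈ range N, F (x + i * α) = ∑ i ∈ range N, (F (x + i * α) - N * I (κ i)) := by
    rw [Finset.sum_sub_distrib, ← Finset.mul_sum, hpI]; simp
  rw [e1]
  refine (Finset.abs_sum_le_sum_abs _ _).trans ((Finset.sum_le_sum hpt).trans ?_)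
  rw [hpD]
  -- telescoping
  have tel : ∀ M : ℕ, ∑ k ∈ range M, D k =
      W (x + M / N) + W (x + (M - 1) / N) - W x - W (x + (-1) / N) := by
    intro M
    induction M with
    | zero => simp
    | succ M ih =>
      rw [Finset.sum_range_succ, ih]
      simp only [hD]
      push_cast
      rw [add_sub_cancel_right]
      ring
  rw [tel, div_self (by positivity)]
  have i0 : 0 ≤ 1 / (N : ℝ) := by positivity
  have m1 : (-1 : ℝ) ∈ Set.Icc (-1 : ℝ) 3 := by norm_num
  have m3 : (3 : ℝ) ∈ Set.Icc (-1 : ℝ) 3 := by norm_num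
  have q1 : x + 1 ∈ Set.Icc (-1 : ℝ) 3 := by constructor <;> linarith
  have q2 : x + ((N : ℝ) - 1) / N ∈ Set.Icc (-1 : ℝ) 3 := by
    rw [sub_div, div_self (by positivity)]; constructor <;> linarith
  have q3 : x ∈ Set.Icc (-1 : ℝ) 3 := by constructor <;> linarith
  have q4 : x + (-1) / (N : ℝ) ∈ Set.Icc (-1 : ℝ) 3 := by
    rw [neg_div]; constructor <;> linarith
  linarith [hW q1 m3 q1.2, hW q2 m3 q2.2, hW m1 q3 q3.1, hW m1 q4 q4.1]

end QP

namespace QP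

variable {𝔭 : UnitAddCircle → ℝ} {α : ℝ} {x : UnitAddCircle} {Ω : Type} [MeasurableSpace Ω]
  {ℙ : Measure Ω} {ξ : ℕ → Ω → ℤ}

lemma step_nonneg (h𝔭 : ∀ z, 0 ≤ 𝔭 z ∧ 𝔭 z ≤ 1) (i j : ℤ) : 0 ≤ stepProb 𝔭 α x i j := by
  unfold stepProb
  split_ifs
  · exact (h𝔭 _).1
  · linarith [(h𝔭 (pt α x i)).2]
  · exact le_rfl

lemma path_meas (hw : IsQPWalk 𝔭 α x 0 ℙ ξ) (n : ℕ) :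
    Measurable (fun ω => fun i : Fin (n + 1) => ξ i ω) :=
  measurable_pi_lambda _ (fun i => hw.2.1 i)

lemma markov_step (h𝔭 : ∀ z, 0 ≤ 𝔭 z ∧ 𝔭 z ≤ 1) (hw : IsQPWalk 𝔭 α x 0 ℙ ξ) (n : ℕ)
    (B : Set (Fin (n + 1) → ℤ)) (j a : ℤ) (hB : ∀ k ∈ B, k (Fin.last n) = j) :
    ℙ {ω | (fun i : Fin (n + 1) => ξ i ω) ∈ B ∧ ξ (n + 1) ω = a} =
      ℙ {ω | (fun i : Fin (n + 1) => ξ i ω) ∈ B} * ENNReal.ofReal (stepProb 𝔭 α x j a) := by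
  have hm := path_meas hw n
  have hBm : MeasurableSet B := B.to_countable.measurableSet
  have hE : MeasurableSet {ω | ξ (n + 1) ω = a} := hw.2.1 (n + 1) (measurableSet_singleton a)
  have l1 : ℙ {ω | (fun i : Fin (n + 1) => ξ i ω) ∈ B ∧ ξ (n + 1) ω = a} =
      (ℙ.restrict {ω | ξ (n + 1) ω = a}).map (fun ω => fun i : Fin (n + 1) => ξ i ω) B := by
    rw [Measure.map_apply hm hBm, Measure.restrict_apply (hm hBm)]; rfl
  have l2 : ℙ {ω | (fun i : Fin (n + 1) => ξ i ω) ∈ B} =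
      ℙ.map (fun ω => fun i : Fin (n + 1) => ξ i ω) B := by
    rw [Measure.map_apply hm hBm]; rfl
  rw [l1, l2, ← Measure.tsum_indicator_apply_singleton _ B hBm,
    ← Measure.tsum_indicator_apply_singleton _ B hBm, ← ENNReal.tsum_mul_right]
  congr 1; ext k
  by_cases hk : k ∈ B
  · rw [Set.indicator_of_mem hk, Set.indicator_of_mem hk]
    have hkm : MeasurableSet {k} := measurableSet_singleton k
    rw [Measure.map_apply hm hkm, Measure.restrict_apply (hm hkm), Measure.map_apply hm hkm]
    set k' : ℕ → ℤ := fun i => if h : i < n + 1 then k ⟨i, h⟩ else a with hk'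
    have hk'i : ∀ i (h : i < n + 1), k' i = k ⟨i, h⟩ := fun i h => dif_pos h
    have hk'l : k' (n + 1) = a := by simp [hk']
    have hk'n : k' n = j := by rw [hk'i n (by omega)]; exact hB k hk
    have s2 : (fun ω => fun i : Fin (n + 1) => ξ i ω) ⁻¹' {k} = {ω | ∀ i ≤ n, ξ i ω = k' i} := by
      ext ω
      constructor
      · intro h i hi
        have h : (fun i : Fin (n + 1) => ξ i ω) = k := h
        rw [hk'i i (by omega), ← h]
      · intro h
        have h : ∀ i ≤ n, ξ i ω = k' i := h
        show (fun i : Fin (n + 1) => ξ i ω) = k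
        ext i
        rw [h i (by omega), hk'i i i.2]
    have s1 : (fun ω => fun i : Fin (n + 1) => ξ i ω) ⁻¹' {k} ∩ {ω | ξ (n + 1) ω = a} =
        {ω | ∀ i ≤ n + 1, ξ i ω = k' i} := by
      rw [s2]
      ext ω
      constructor
      · rintro ⟨h1, h2⟩ i hi
        have h1 : ∀ i ≤ n, ξ i ω = k' i := h1
        have h2 : ξ (n + 1) ω = a := h2
        rcases Nat.lt_or_ge n i with h | h
        · have : i = n + 1 := by omega
          subst this; rw [hk'l, h2]
        · exact h1 i h
      · intro h
        have h : ∀ i ≤ n + 1, ξ i ω = k' i := h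
        refine ⟨fun i hi => h i (by omega), ?_⟩
        show ξ (n + 1) ω = a
        rw [h _ le_rfl, hk'l]
    rw [s1, s2, hw.2.2, hw.2.2, Finset.prod_range_succ, hk'l, hk'n, ← mul_assoc, ENNReal.ofReal_mul]
    refine mul_nonneg ?_ (Finset.prod_nonneg (fun i _ => step_nonneg h𝔭 _ _))
    split_ifs <;> norm_num
  · rw [Set.indicator_of_notMem hk, Set.indicator_of_notMem hk, zero_mul]

lemma one_step (h𝔭 : ∀ z, 0 ≤ 𝔭 z ∧ 𝔭 z ≤ 1) (hw : IsQPWalk 𝔭 α x 0 ℙ ξ) (n : ℕ)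
    (B : Set (Fin (n + 1) → ℤ)) (a : ℤ) :
    (ℙ {ω | (fun i : Fin (n + 1) => ξ i ω) ∈ B ∧ ξ (n + 1) ω = a}).toReal =
      (ℙ {ω | (fun i : Fin (n + 1) => ξ i ω) ∈ B ∧ ξ n ω = a - 1}).toReal * 𝔭 (pt α x (a - 1)) +
      (ℙ {ω | (fun i : Fin (n + 1) => ξ i ω) ∈ B ∧ ξ n ω = a + 1}).toReal *
        (1 - 𝔭 (pt α x (a + 1))) := by
  haveI := hw.1
  have hm := path_meas hw n
  have hE : MeasurableSet {ω | ξ (n + 1) ω = a} := hw.2.1 (n + 1) (measurableSet_singleton a)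
  set Bj : ℤ → Set (Fin (n + 1) → ℤ) := fun j => B ∩ {k | k (Fin.last n) = j} with hBj
  have hBjs : ∀ j, {ω | (fun i : Fin (n + 1) => ξ i ω) ∈ Bj j} =
      {ω | (fun i : Fin (n + 1) => ξ i ω) ∈ B ∧ ξ n ω = j} := fun j => rfl
  have hu : {ω | (fun i : Fin (n + 1) => ξ i ω) ∈ B ∧ ξ (n + 1) ω = a} =
      ⋃ j, {ω | (fun i : Fin (n + 1) => ξ i ω) ∈ Bj j ∧ ξ (n + 1) ω = a} := by
    ext ω
    rw [Set.mem_iUnion]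
    constructor
    · rintro ⟨h1, h2⟩
      exact ⟨ξ n ω, ⟨h1, rfl⟩, h2⟩
    · rintro ⟨j, ⟨h1, -⟩, h2⟩
      exact ⟨h1, h2⟩
  rw [hu, measure_iUnion]
  · have : ∀ j, ℙ {ω | (fun i : Fin (n + 1) => ξ i ω) ∈ Bj j ∧ ξ (n + 1) ω = a} =
        ℙ {ω | (fun i : Fin (n + 1) => ξ i ω) ∈ B ∧ ξ n ω = j} *
          ENNReal.ofReal (stepProb 𝔭 α x j a) := fun j => by
      rw [markov_step h𝔭 hw n (Bj j) j a (fun k hk => hk.2), hBjs]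
    simp_rw [this]
    rw [tsum_eq_sum (s := {a - 1, a + 1})]
    · rw [Finset.sum_pair (by omega), ENNReal.toReal_add, ENNReal.toReal_mul, ENNReal.toReal_mul,
        ENNReal.toReal_ofReal (step_nonneg h𝔭 _ _), ENNReal.toReal_ofReal (step_nonneg h𝔭 _ _)]
      · congr 2
        · unfold stepProb; rw [if_pos (by ring)]
        · unfold stepProb; rw [if_neg (by omega), if_pos (by ring)]
      · exact ENNReal.mul_ne_top (measure_ne_top _ _) ENNReal.ofReal_ne_top
      · exact ENNReal.mul_ne_top (measure_ne_top _ _) ENNReal.ofReal_ne_top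
    · intro j hj
      simp only [Finset.mem_insert, Finset.mem_singleton, not_or] at hj
      have : stepProb 𝔭 α x j a = 0 := by
        unfold stepProb; rw [if_neg (by omega), if_neg (by omega)]
      rw [this]; simp
  · intro i j hij
    refine Set.disjoint_left.2 ?_
    rintro ω ⟨⟨-, h1⟩, -⟩ ⟨⟨-, h2⟩, -⟩
    have h1 : ξ n ω = i := h1
    have h2 : ξ n ω = j := h2
    exact hij (h1.symm.trans h2)
  · intro j
    exact (hm (Bj j).to_countable.measurableSet).inter hE

lemma pOf_mem (𝔣 : UnitAddCircle → ℝ) (z : UnitAddCircle) : 0 ≤ pOf 𝔣 z ∧ pOf 𝔣 z ≤ 1 := by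
  unfold pOf
  have := Real.exp_pos (𝔣 z)
  refine ⟨by positivity, ?_⟩
  rw [div_le_one (by positivity)]; linarith

/-- the environment seen from zero -/
def env (𝔣 : UnitAddCircle → ℝ) (α : ℝ) (x : UnitAddCircle) : ℤ → ℝ := fun j => 𝔣 (pt α x j)

lemma pOf_eq (𝔣 : UnitAddCircle → ℝ) (α : ℝ) (x : UnitAddCircle) (j : ℤ) :
    pOf 𝔣 (pt α x j) = ep (env 𝔣 α x) j := rfl

lemma ww_LL (f g : ℤ → ℝ) (a : ℤ) : ww f a * LL f g a =
    ww f (a - 1) * g (a - 1) * ep f (a - 1) + ww f (a + 1) * g (a + 1) * (1 - ep f (a + 1)) := by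
  have h1 := ww_ep f a
  have h2 := ww_eq f a
  have h3 := ww_ep f (a - 1)
  have h4 := ww_eq f (a + 1)
  rw [sub_add_cancel] at h3
  unfold LL
  linear_combination g (a + 1) * (h1 - h4) + g (a - 1) * (h2 - h3)

lemma prob_eq {𝔣 : UnitAddCircle → ℝ} (hw : IsQPWalk (pOf 𝔣) α x 0 ℙ ξ) (n : ℕ) (a : ℤ) :
    (ℙ {ω | ξ n ω = a}).toReal = ww (env 𝔣 α x) a * hh (env 𝔣 α x) n a / ww (env 𝔣 α x) 0 := by
  induction n generalizing a with
  | zero =>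
    have := hw.2.2 0 (fun _ => a)
    have e : {ω | ξ 0 ω = a} = {ω | ∀ i ≤ 0, ξ i ω = a} := by
      ext ω; simp
    rw [e, this]
    simp only [Finset.range_zero, Finset.prod_empty, mul_one, hh, Function.iterate_zero, id, dl]
    split_ifs with h
    · subst h
      rw [mul_one, div_self (ww_pos _ _).ne']; simp
    · simp
  | succ n ih =>
    have := one_step (pOf_mem 𝔣) hw n Set.univ a
    simp only [Set.mem_univ, true_and] at this
    rw [this, ih, ih, pOf_eq, pOf_eq, hh_succ, ww_LL]
    ring

lemma taboo_eq {𝔣 : UnitAddCircle → ℝ} (hw : IsQPWalk (pOf 𝔣) α x 0 ℙ ξ) (n : ℕ) (a : ℤ) :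
    (ℙ (firstRetSet ξ (n + 1) a)).toReal =
      ww (env 𝔣 α x) a * tau (env 𝔣 α x) n a / ww (env 𝔣 α x) 0 := by
  induction n generalizing a with
  | zero =>
    have e : firstRetSet ξ (0 + 1) a = {ω | ξ 1 ω = a} := by
      ext ω
      constructor
      · exact fun h => h.2
      · exact fun h => ⟨fun i h1 h2 => by omega, h⟩
    rw [e, prob_eq hw]
    rfl
  | succ n ih =>
    set B : Set (Fin (n + 1 + 1) → ℤ) := {k | ∀ i : Fin (n + 1 + 1), 1 ≤ (i : ℕ) → k i ≠ 0} with hB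
    have e : firstRetSet ξ (n + 1 + 1) a =
        {ω | (fun i : Fin (n + 1 + 1) => ξ i ω) ∈ B ∧ ξ (n + 1 + 1) ω = a} := by
      ext ω
      constructor
      · rintro ⟨h1, h2⟩
        exact ⟨fun i hi => h1 i hi i.2, h2⟩
      · rintro ⟨h1, h2⟩
        exact ⟨fun i hi hi2 => h1 ⟨i, hi2⟩ hi, h2⟩
    have e2 : ∀ j, (ℙ {ω | (fun i : Fin (n + 1 + 1) => ξ i ω) ∈ B ∧ ξ (n + 1) ω = j}).toReal =
        ww (env 𝔣 α x) j * (if j = 0 then 0 else tau (env 𝔣 α x) n j) / ww (env 𝔣 α x) 0 := by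
      intro j
      by_cases hj : j = 0
      · have : {ω | (fun i : Fin (n + 1 + 1) => ξ i ω) ∈ B ∧ ξ (n + 1) ω = j} = ∅ := by
          rw [Set.eq_empty_iff_forall_notMem]
          rintro ω ⟨h1, h2⟩
          exact h1 (Fin.last (n + 1)) (by simp) (by subst hj; exact h2)
        rw [this, if_pos hj]; simp
      · rw [if_neg hj, ← ih]
        congr 2
        ext ω
        constructor
        · rintro ⟨h1, h2⟩
          exact ⟨fun i hi hi2 => h1 ⟨i, by omega⟩ hi, h2⟩
        · rintro ⟨h1, h2⟩
          refine ⟨fun i hi => ?_, h2⟩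
          show ξ i ω ≠ 0
          rcases Nat.lt_or_ge i (n + 1) with h | h
          · exact h1 i hi h
          · have : (i : ℕ) = n + 1 := by omega
            rw [this]
            intro h3
            have h2 : ξ (n + 1) ω = j := h2
            exact hj (h2.symm.trans h3)
    rw [e, one_step (pOf_mem 𝔣) hw (n + 1) B a, e2, e2, pOf_eq, pOf_eq]
    have ht : tau (env 𝔣 α x) (n + 1) a =
        LL (env 𝔣 α x) (fun j => if j = 0 then 0 else tau (env 𝔣 α x) n j) a := by
      simp [tau]
    rw [ht, ww_LL]
    ring

lemma mu_eq {𝔣 : UnitAddCircle → ℝ} (hw : IsQPWalk (pOf 𝔣) α x 0 ℙ ξ)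
    (hR : Rec (env 𝔣 α x)) (a : ℤ) :
    muW ℙ ξ a = ww (env 𝔣 α x) a / ww (env 𝔣 α x) 0 := by
  unfold muW
  simp_rw [taboo_eq hw]
  have := ((tau_hasSum hR a).mul_left (ww (env 𝔣 α x) a)).div_const (ww (env 𝔣 α x) 0)
  rw [this.tsum_eq, mul_one]

lemma env_cont {𝔣 : UnitAddCircle → ℝ} (h : Continuous 𝔣) (α : ℝ) : Continuous (env 𝔣 α) := by
  refine continuous_pi (fun j => ?_)
  unfold env pt
  exact h.comp (continuous_id.add continuous_const)

lemma env_ell {𝔣 : UnitAddCircle → ℝ} (h : Continuous 𝔣) (α : ℝ) :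
    ∃ c, ∀ x, Ell c (env 𝔣 α x) := by
  obtain ⟨M, hM⟩ := isCompact_univ.exists_bound_of_continuousOn h.continuousOn
  refine ⟨1 / (1 + Real.exp M), fun x => ⟨by positivity, fun j => ?_⟩⟩
  have := hM (pt α x j) (Set.mem_univ _)
  rw [Real.norm_eq_abs, abs_le] at this
  have e1 : Real.exp (env 𝔣 α x j) ≤ Real.exp M := Real.exp_le_exp.2 this.2
  have e2 : Real.exp (-M) ≤ Real.exp (env 𝔣 α x j) := Real.exp_le_exp.2 this.1
  have p1 := Real.exp_pos (env 𝔣 α x j)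
  have p2 := Real.exp_pos M
  constructor
  · unfold ep
    rw [div_le_div_iff₀ (by positivity) (by positivity)]
    have : 1 ≤ Real.exp (env 𝔣 α x j) * Real.exp M := by
      rw [← Real.exp_add]; apply Real.one_le_exp; unfold env; linarith
    nlinarith
  · rw [one_sub_ep]
    exact one_div_le_one_div_of_le (by positivity) (by linarith)

lemma env_rec {𝔣 : UnitAddCircle → ℝ} (h : ZeroMeanBV 𝔣) {α : ℝ} (hα : Irrational α)
    (x : UnitAddCircle) : Rec (env 𝔣 α x) := by
  obtain ⟨hc, hbv, hint⟩ := h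
  set F : ℝ → ℝ := fun t => 𝔣 (t : UnitAddCircle) with hF
  have hFc : Continuous F := hc.comp (AddCircle.continuous_mk' 1)
  have hper : ∀ t, F (t + 1) = F t := by
    intro t
    simp only [hF]
    rw [AddCircle.coe_add_period]
  have hFi : ∀ t, ∫ s in t..t + 1, F s = 0 := by
    intro t
    rw [← hint]; exact UnitAddCircle.intervalIntegral_preimage t 𝔣
  obtain ⟨W, hW, hFW⟩ := exists_control hbv hper
  set C := 2 * (W 3 - W (-1)) with hC
  have key : ∀ r : ℚ, |α - r| < 1 / (r.den : ℝ) ^ 2 → ∀ y : UnitAddCircle,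
      |∑ i ∈ Finset.range r.den, 𝔣 (pt α y (i : ℤ))| ≤ C := by
    intro r hr y
    set t : ℝ := (AddCircle.equivIco 1 0 y : ℝ) with ht
    have hty : (t : UnitAddCircle) = y := AddCircle.coe_equivIco
    have htm : t ∈ Set.Ico (0 : ℝ) (0 + 1) := (AddCircle.equivIco 1 0 y).2
    have := denjoy_koksma hFc hper hFi hW hFW hr t htm.1 (by have := htm.2; linarith)
    refine le_trans (le_of_eq ?_) this
    congr 1
    refine Finset.sum_congr rfl (fun i _ => ?_)
    simp only [hF, pt]
    rw [AddCircle.coe_add, hty]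
    simp
  refine rec_of_bdd _ C (fun M => ?_)
  obtain ⟨r, hrM, hr⟩ := exists_large_den hα M
  refine ⟨r.den, hrM, ?_, ?_⟩
  · have hS : ∀ n : ℕ, SS (env 𝔣 α x) n = ∑ i ∈ Finset.range n, 𝔣 (pt α x (i : ℤ)) := by
      intro n
      induction n with
      | zero => simp [SS_zero]
      | succ n ih => push_cast; rw [SS_succ, ih, Finset.sum_range_succ]; rfl
    rw [hS]
    exact (le_abs_self _).trans (key r hr x)
  · have hS : ∀ (y : UnitAddCircle) (m n : ℕ), SS (env 𝔣 α x) (-(m : ℤ) + n) =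
        SS (env 𝔣 α x) (-(m : ℤ)) + ∑ i ∈ Finset.range n, 𝔣 (pt α (pt α x (-(m : ℤ))) (i : ℤ)) := by
      intro y m n
      induction n with
      | zero => simp
      | succ n ih =>
        push_cast
        rw [← add_assoc, SS_succ, ih, Finset.sum_range_succ, add_assoc]
        congr 2
        unfold env pt
        congr 1
        rw [add_assoc, ← AddCircle.coe_add]
        congr 2
        push_cast; ring
    have := hS x r.den r.den
    rw [neg_add_cancel, SS_zero] at this
    have k := key r hr (pt α x (-(r.den : ℤ)))
    rw [abs_le] at k
    linarith [k.1]

lemma uniform_pair {K : Set (ℤ → ℝ)} (hK : IsCompact K) {c : ℝ} (hE : ∀ f ∈ K, Ell c f)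
    (hR : ∀ f ∈ K, Rec f) {ε : ℝ} (hε : 0 < ε) (a b : ℤ) :
    ∀ᶠ m : ℕ in atTop, ∀ f ∈ K, |ww f a / ww f b * (HH f m a / HH f m b - 1)| < ε := by
  have hcw : Continuous (fun f : ℤ → ℝ => ww f a / ww f b) :=
    (cont_ww a).div (cont_ww b) (fun f => (ww_pos f b).ne')
  obtain ⟨M, hM⟩ := hK.exists_bound_of_continuousOn hcw.continuousOn
  have h1 := (main_conv hK hE hR a).div (main_conv hK hE hR b) one_ne_zero
  rw [div_one] at h1
  have h2 : Tendsto (fun z : ℕ × (ℤ → ℝ) => HH z.2 z.1 a / HH z.2 z.1 b) (atTop ×ˢ 𝓟 K) (nhds 1) :=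
    h1.congr (fun z => div_div_div_cancel_right₀ (AA_pos z.2 z.1).ne' _ _)
  have hδ : 0 < ε / (|M| + 1) := by positivity
  have h3 := h2.eventually (Metric.ball_mem_nhds 1 hδ)
  rw [eventually_prod_principal_iff] at h3
  filter_upwards [h3] with m hm f hf
  have h4 := hm f hf
  rw [Real.dist_eq] at h4
  rw [abs_mul]
  have h5 : |ww f a / ww f b| ≤ |M| + 1 := by
    have := hM f hf
    rw [Real.norm_eq_abs] at this
    linarith [le_abs_self M]
  calc _ ≤ (|M| + 1) * |HH f m a / HH f m b - 1| := mul_le_mul_of_nonneg_right h5 (abs_nonneg _)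
    _ < (|M| + 1) * (ε / (|M| + 1)) := mul_lt_mul_of_pos_left h4 (by positivity)
    _ = ε := by field_simp

lemma hh_eq_HH (f : ℤ → ℝ) (n : ℕ) (a : ℤ) (ha : a % 2 = (n : ℤ) % 2) : hh f n a = HH f (n / 2) a := by
  unfold HH
  split_ifs with h
  · have : n = 2 * (n / 2) := by have := Int.even_iff.1 h; omega
    rw [← this]
  · have : n = 2 * (n / 2) + 1 := by have := Int.odd_iff.1 (Int.not_even_iff_odd.1 h); omega
    rw [← this]

end QP


/-- Theorem A, Kingman–Orey strong ratio limit property: if `𝔣` is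
continuous of bounded variation with `∫_𝕋 𝔣 = 0`, then for every `ε > 0` and `q ≥ 2`
there is `n₀` such that `|ℙ_x(ξ_n = a)/ℙ_x(ξ_n = b) - μ_{x,a}/μ_{x,b}| < ε` for all
`n ≥ n₀`, all `x ∈ 𝕋` and all `a, b ∈ [-q, q]` with the same parity as `n`. -/
theorem statement1 (α : ℝ) (hα : Irrational α) (𝔣 : UnitAddCircle → ℝ)
    (h𝔣 : ZeroMeanBV 𝔣) (ε : ℝ) (hε : 0 < ε) (q : ℕ) (hq : 2 ≤ q) :
    ∃ n₀ : ℕ, ∀ n : ℕ, n₀ ≤ n →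
      ∀ (x : UnitAddCircle) (Ω : Type) [MeasurableSpace Ω] (ℙ : Measure Ω)
        (ξ : ℕ → Ω → ℤ), IsQPWalk (pOf 𝔣) α x 0 ℙ ξ →
        ∀ a b : ℤ, |a| ≤ (q : ℤ) → |b| ≤ (q : ℤ) →
          a % 2 = (n : ℤ) % 2 → b % 2 = (n : ℤ) % 2 →
          |(ℙ {ω | ξ n ω = a}).toReal / (ℙ {ω | ξ n ω = b}).toReal -
            muW ℙ ξ a / muW ℙ ξ b| < ε := by

  classical
  obtain ⟨c, hc⟩ := QP.env_ell h𝔣.1 α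
  have hK : IsCompact (Set.range (QP.env 𝔣 α)) := isCompact_range (QP.env_cont h𝔣.1 α)
  have hE : ∀ f ∈ Set.range (QP.env 𝔣 α), QP.Ell c f := by rintro _ ⟨x, rfl⟩; exact hc x
  have hR : ∀ f ∈ Set.range (QP.env 𝔣 α), QP.Rec f := by
    rintro _ ⟨x, rfl⟩; exact QP.env_rec h𝔣 hα x
  have hev : ∀ᶠ m : ℕ in atTop, ∀ ab ∈ (Finset.Icc (-(q : ℤ)) q) ×ˢ (Finset.Icc (-(q : ℤ)) q),
      ∀ f ∈ Set.range (QP.env 𝔣 α),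
        |QP.ww f ab.1 / QP.ww f ab.2 * (QP.HH f m ab.1 / QP.HH f m ab.2 - 1)| < ε :=
    (Filter.eventually_all_finset _).2 (fun ab _ => QP.uniform_pair hK hE hR hε ab.1 ab.2)
  obtain ⟨m₀, hm₀⟩ := eventually_atTop.1 hev
  refine ⟨2 * m₀ + 2, fun n hn x Ω _ ℙ ξ hw a b ha hb hpa hpb => ?_⟩
  have hab : (a, b) ∈ (Finset.Icc (-(q : ℤ)) q) ×ˢ (Finset.Icc (-(q : ℤ)) q) := by
    rw [Finset.mem_product, Finset.mem_Icc, Finset.mem_Icc]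
    exact ⟨abs_le.1 ha, abs_le.1 hb⟩
  have := hm₀ (n / 2) (by omega) (a, b) hab (QP.env 𝔣 α x) ⟨x, rfl⟩
  have hRx := QP.env_rec h𝔣 hα x
  rw [QP.prob_eq hw, QP.prob_eq hw, QP.mu_eq hw hRx, QP.mu_eq hw hRx, QP.hh_eq_HH _ n a hpa,
    QP.hh_eq_HH _ n b hpb]
  refine lt_of_eq_of_lt ?_ this
  congr 1
  have w0 := (QP.ww_pos (QP.env 𝔣 α x) 0).ne'
  rw [div_div_div_cancel_right₀ w0, div_div_div_cancel_right₀ w0, mul_div_mul_comm]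
  ring
end
end
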